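/- Let σ = (σ_1 ≥ … ≥ σ_{2p}) be a weakly decreasing sequence of real numbers, S = diag(σ), and ν = (ν_1 ≥ … ≥ ν_p) a weakly decreasing sequence of real numbers. Then there exists a real orthogonal 2p×2p matrix J with J² = −Id such that S + J⁻¹ S J has ordered spectrum ν^{(2)}, if and only if there exist real symmetric p×p matrices a and b with ordered spectra σ_- and σ_+ respectively such that a + b has ordered spectrum ν. -/

import Mathlib

open Polynomial in
/-- `μ` (weakly decreasing) is the ordered spectrum of the real matrix `A`:
the characteristic polynomial of `A` is `∏ i (X - μ i)`, i.e. the `μ i` are the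
eigenvalues of `A` with multiplicity, listed in weakly decreasing order. -/
def HasOrdSpecR {n : ℕ} (A : Matrix (Fin n) (Fin n) ℝ) (μ : Fin n → ℝ) : Prop :=
  Antitone μ ∧ A.charpoly = ∏ i, (X - C (μ i))

open Polynomial in
/-- `μ` (weakly decreasing, real) is the ordered spectrum of the complex matrix `A`. -/
def HasOrdSpecC {n : ℕ} (A : Matrix (Fin n) (Fin n) ℂ) (μ : Fin n → ℝ) : Prop :=
  Antitone μ ∧ A.charpoly = ∏ i, (X - C ((μ i : ℂ)))

/-- For `σ = (σ₁ ≥ … ≥ σ_{2p})`, `sminusR σ = σ₋ = (σ₁, σ₃, …, σ_{2p-1})`. -/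
def sminusR {p : ℕ} (σ : Fin (2 * p) → ℝ) : Fin p → ℝ :=
  fun i => σ ⟨2 * i.1, by have := i.2; omega⟩

/-- For `σ = (σ₁ ≥ … ≥ σ_{2p})`, `splusR σ = σ₊ = (σ₂, σ₄, …, σ_{2p})`. -/
def splusR {p : ℕ} (σ : Fin (2 * p) → ℝ) : Fin p → ℝ :=
  fun i => σ ⟨2 * i.1 + 1, by have := i.2; omega⟩

/-- For `ν = (ν₁ ≥ … ≥ ν_p)`, `dupR ν = ν⁽²⁾ = (ν₁, ν₁, ν₂, ν₂, …, ν_p, ν_p)`. -/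
def dupR {p : ℕ} (ν : Fin p → ℝ) : Fin (2 * p) → ℝ :=
  fun i => ν ⟨i.1 / 2, by have := i.2; omega⟩

section
open Matrix

namespace HornHalf

theorem exists_equiv_of_prod {ι κ : Type*} [Fintype ι] [Fintype κ] (α : ι → ℝ) (μ : κ → ℝ)
    (h : ∏ i, (Polynomial.X - Polynomial.C (α i)) = ∏ i, (Polynomial.X - Polynomial.C (μ i))) :
    ∃ e : ι ≃ κ, ∀ i, α i = μ (e i) := by
  classical
  have h1 : (Finset.univ.val.map α) = (Finset.univ.val.map μ) := by
    have := congrArg Polynomial.roots h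
    rw [Polynomial.roots_prod _ _ (Finset.prod_ne_zero_iff.2 fun i _ => Polynomial.X_sub_C_ne_zero _),
      Polynomial.roots_prod _ _ (Finset.prod_ne_zero_iff.2 fun i _ => Polynomial.X_sub_C_ne_zero _)] at this
    simpa [Polynomial.roots_X_sub_C, Multiset.bind_singleton] using this
  have h2 : ∀ y : ℝ, Nonempty ({i // α i = y} ≃ {k // μ k = y}) := by
    intro y
    have := congrArg (Multiset.count y) h1
    rw [Multiset.count_map, Multiset.count_map] at this
    apply Fintype.card_eq.1
    rw [Fintype.card_subtype, Fintype.card_subtype]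
    simpa [Finset.card_def, Finset.filter_val, eq_comm] using this
  have f := fun y => (h2 y).some
  refine ⟨(Equiv.sigmaFiberEquiv α).symm.trans ((Equiv.sigmaCongrRight f).trans (Equiv.sigmaFiberEquiv μ)), ?_⟩
  intro i
  simp only [Equiv.trans_apply, Equiv.sigmaFiberEquiv, Equiv.coe_fn_symm_mk, Equiv.sigmaCongrRight_apply,
    Equiv.coe_fn_mk, Sigma.map]
  exact ((f (α i) ⟨i, rfl⟩).2).symm

theorem charpoly_conj {ι : Type*} [Fintype ι] [DecidableEq ι] (U A : Matrix ι ι ℝ) (h : Uᵀ * U = 1) :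
    (U * A * Uᵀ).charpoly = A.charpoly := by
  rw [Matrix.charpoly_mul_comm, ← Matrix.mul_assoc, h, Matrix.one_mul]

/-- spectral theorem, real symmetric matrices, with no control on the order -/
theorem spectral0 {ι : Type*} [Fintype ι] [DecidableEq ι] (A : Matrix ι ι ℝ) (hA : A.IsSymm) :
    ∃ (U : Matrix ι ι ℝ) (μ : ι → ℝ), Uᵀ * U = 1 ∧ A = U * diagonal μ * Uᵀ := by
  have hH : A.IsHermitian := by
    rw [Matrix.IsHermitian, conjTranspose_eq_transpose_of_trivial]; exact hA
  refine ⟨hH.eigenvectorUnitary, hH.eigenvalues, ?_, ?_⟩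
  · have := (Unitary.mem_iff.1 hH.eigenvectorUnitary.2).1
    rwa [star_eq_conjTranspose, conjTranspose_eq_transpose_of_trivial] at this
  · have := hH.spectral_theorem
    rw [Unitary.conjStarAlgAut_apply] at this
    rw [star_eq_conjTranspose, conjTranspose_eq_transpose_of_trivial] at this
    exact this

theorem charpoly_diag {ι : Type*} [Fintype ι] [DecidableEq ι] (U : Matrix ι ι ℝ) (μ : ι → ℝ)
    (h : Uᵀ * U = 1) :
    (U * diagonal μ * Uᵀ).charpoly = ∏ i, (Polynomial.X - Polynomial.C (μ i)) := by
  rw [charpoly_conj _ _ h, Matrix.charpoly_diagonal]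

/-- spectral theorem with prescribed ordering of the eigenvalues -/
theorem spectral {ι κ : Type*} [Fintype ι] [DecidableEq ι] [Fintype κ] [DecidableEq κ]
    (A : Matrix ι ι ℝ) (hA : A.IsSymm) (μ : κ → ℝ)
    (h : A.charpoly = ∏ i, (Polynomial.X - Polynomial.C (μ i))) :
    ∃ (U : Matrix ι κ ℝ), Uᵀ * U = 1 ∧ U * Uᵀ = 1 ∧ A = U * diagonal μ * Uᵀ := by
  obtain ⟨U, α, hU, rfl⟩ := spectral0 A hA
  rw [charpoly_diag _ _ hU] at h
  obtain ⟨e, he⟩ := exists_equiv_of_prod α μ h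
  have hU' := mul_eq_one_comm.1 hU
  refine ⟨U.submatrix id e.symm, ?_, ?_, ?_⟩
  · rw [transpose_submatrix, ← submatrix_mul _ _ _ _ _ Function.bijective_id, hU]
    simp
  · rw [transpose_submatrix, ← submatrix_mul _ _ _ _ _ e.symm.bijective, hU']
    simp
  · have : diagonal μ = (diagonal α).submatrix e.symm e.symm := by
      rw [submatrix_diagonal_equiv]
      congr 1; ext i; simp [he]
    rw [this, transpose_submatrix, ← submatrix_mul _ _ _ _ _ e.symm.bijective,
      ← submatrix_mul _ _ _ _ _ e.symm.bijective]
    simp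

/-- simultaneous diagonalisation with a diagonal matrix -/
theorem spectral_comm {ι : Type*} [Fintype ι] [DecidableEq ι] (A : Matrix ι ι ℝ) (hA : A.IsSymm)
    (δ : ι → ℝ) (hc : A * diagonal δ = diagonal δ * A) :
    ∃ (U : Matrix ι ι ℝ) (μ : ι → ℝ), Uᵀ * U = 1 ∧ A = U * diagonal μ * Uᵀ ∧
      ∀ i j, δ i ≠ δ j → U i j = 0 := by
  classical
  have hent : ∀ i j, δ i ≠ δ j → A i j = 0 := by
    intro i j hij
    have := congrFun (congrFun hc i) j
    rw [mul_diagonal, diagonal_mul] at this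
    have h2 : (δ i - δ j) * A i j = 0 := by linarith
    exact (mul_eq_zero.1 h2).resolve_left (sub_ne_zero.2 hij)
  let r := Set.range δ
  let f : ι → r := fun i => ⟨δ i, i, rfl⟩
  have hb : ∀ y : r, ∃ (U : Matrix {i // f i = y} {i // f i = y} ℝ) (μ : {i // f i = y} → ℝ),
      Uᵀ * U = 1 ∧ A.submatrix Subtype.val Subtype.val = U * diagonal μ * Uᵀ := by
    intro y
    apply spectral0
    exact hA.submatrix _
  choose U μ hU hUA using hb
  let e := Equiv.sigmaFiberEquiv f
  let B := blockDiagonal' U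
  have hB : Bᵀ * B = 1 := by
    rw [blockDiagonal'_transpose, ← blockDiagonal'_mul]
    simp only [hU]
    exact blockDiagonal'_one
  have hAe : A.submatrix e e = B * diagonal (fun s : (Σ y, {i // f i = y}) => μ s.1 s.2) * Bᵀ := by
    rw [← blockDiagonal'_diagonal, blockDiagonal'_transpose, ← blockDiagonal'_mul, ← blockDiagonal'_mul]
    ext ⟨y, i⟩ ⟨z, j⟩
    by_cases h : y = z
    · subst h
      rw [blockDiagonal'_apply_eq, ← hUA]
      rfl
    · rw [blockDiagonal'_apply_ne _ _ _ h]
      simp only [submatrix_apply]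
      apply hent
      intro h'
      apply h
      have : f i = f j := Subtype.ext h'
      exact i.2.symm.trans (this.trans j.2)
  refine ⟨B.submatrix e.symm e.symm, fun i => μ (f i) ⟨i, rfl⟩, ?_, ?_, ?_⟩
  · rw [transpose_submatrix, ← submatrix_mul _ _ _ _ _ e.symm.bijective, hB]
    simp
  · have : diagonal (fun i => μ (f i) ⟨i, rfl⟩)
      = (diagonal (fun s : (Σ y, {i // f i = y}) => μ s.1 s.2)).submatrix e.symm e.symm := by
      rw [submatrix_diagonal_equiv]
      congr 1
    rw [this, transpose_submatrix, ← submatrix_mul _ _ _ _ _ e.symm.bijective,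
      ← submatrix_mul _ _ _ _ _ e.symm.bijective, ← hAe]
    simp
  · intro i j hij
    simp only [submatrix_apply]
    apply blockDiagonal'_apply_ne
    intro h
    apply hij
    exact congrArg Subtype.val h

end HornHalf
end

section
open Matrix

namespace HornHalf

section Hessian

attribute [local instance] Matrix.linftyOpNormedRing Matrix.linftyOpNormedAlgebra

variable {ι : Type*} [Fintype ι] [DecidableEq ι]

/-- the curve `exp (tX) a exp (-tX)` -/
noncomputable def crv (a X : Matrix ι ι ℝ) (t : ℝ) : Matrix ι ι ℝ :=
  NormedSpace.exp (t • X) * a * NormedSpace.exp (t • (-X))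

theorem crv_zero (a X : Matrix ι ι ℝ) : crv a X 0 = a := by
  simp [crv, NormedSpace.exp_zero]

theorem crv_deriv (a X : Matrix ι ι ℝ) (t : ℝ) :
    HasDerivAt (crv a X) (crv (X * a - a * X) X t) t := by
  have h1 := hasDerivAt_exp_smul_const (𝕂 := ℝ) X t
  have h2 := hasDerivAt_exp_smul_const' (𝕂 := ℝ) (-X) t
  have h3 := (h1.mul_const a).mul h2
  refine h3.congr_deriv ?_
  unfold crv
  noncomm_ring

theorem crv_orth (X : Matrix ι ι ℝ) (hX : Xᵀ = -X) (t : ℝ) :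
    (NormedSpace.exp (t • X))ᵀ = NormedSpace.exp (t • (-X)) ∧
    (NormedSpace.exp (t • X))ᵀ * NormedSpace.exp (t • X) = 1 := by
  have h1 : (NormedSpace.exp (t • X))ᵀ = NormedSpace.exp (t • (-X)) := by
    rw [← Matrix.exp_transpose, transpose_smul, hX]
  refine ⟨h1, ?_⟩
  rw [h1, ← Matrix.exp_add_of_commute]
  · simp [NormedSpace.exp_zero]
  · simp

/-- first and second order necessary conditions at a minimum -/
theorem second_order (a b c : Matrix ι ι ℝ)
    (hmin : ∀ O₁ O₂ O₃ : Matrix ι ι ℝ, O₁ᵀ * O₁ = 1 → O₂ᵀ * O₂ = 1 → O₃ᵀ * O₃ = 1 →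
      trace ((a + b - c) * (a + b - c)) ≤
      trace ((O₁ * a * O₁ᵀ + O₂ * b * O₂ᵀ - O₃ * c * O₃ᵀ) * (O₁ * a * O₁ᵀ + O₂ * b * O₂ᵀ - O₃ * c * O₃ᵀ)))
    (X Y Z : Matrix ι ι ℝ) (hX : Xᵀ = -X) (hY : Yᵀ = -Y) (hZ : Zᵀ = -Z) :
    trace ((a + b - c) * ((X * a - a * X) + (Y * b - b * Y) - (Z * c - c * Z))) = 0 ∧
    ((X * a - a * X) + (Y * b - b * Y) - (Z * c - c * Z) = 0 →
      0 ≤ trace ((a + b - c) * ((X * (X * a - a * X) - (X * a - a * X) * X)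
        + (Y * (Y * b - b * Y) - (Y * b - b * Y) * Y)
        - (Z * (Z * c - c * Z) - (Z * c - c * Z) * Z)))) := by
  set G : Matrix ι ι ℝ → Matrix ι ι ℝ → Matrix ι ι ℝ → ℝ → Matrix ι ι ℝ :=
    fun a b c t => crv a X t + crv b Y t - crv c Z t with hG
  have hGd : ∀ a b c t, HasDerivAt (G a b c)
      (G (X * a - a * X) (Y * b - b * Y) (Z * c - c * Z) t) t := fun a b c t =>
    ((crv_deriv a X t).add (crv_deriv b Y t)).sub (crv_deriv c Z t)
  have hG0 : ∀ a b c, G a b c 0 = a + b - c := by intro a b c; simp [hG, crv_zero]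
  let T : Matrix ι ι ℝ →L[ℝ] ℝ := LinearMap.toContinuousLinearMap (traceLinearMap ι ℝ ℝ)
  have hT : ∀ M, T M = trace M := fun M => rfl
  have hprod : ∀ a b c a' b' c' t, HasDerivAt (fun t => trace (G a b c t * G a' b' c' t))
      (trace (G (X * a - a * X) (Y * b - b * Y) (Z * c - c * Z) t * G a' b' c' t +
        G a b c t * G (X * a' - a' * X) (Y * b' - b' * Y) (Z * c' - c' * Z) t)) t := by
    intro a b c a' b' c' t
    have := T.hasFDerivAt.comp_hasDerivAt t ((hGd a b c t).mul (hGd a' b' c' t))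
    exact this
  set a1 := X * a - a * X
  set b1 := Y * b - b * Y
  set c1 := Z * c - c * Z
  set N : ℝ → ℝ := fun t => trace (G a b c t * G a b c t) with hN
  have hN1 : ∀ t, HasDerivAt N (2 * trace (G a b c t * G a1 b1 c1 t)) t := by
    intro t
    refine (hprod a b c a b c t).congr_deriv ?_
    rw [trace_add, trace_mul_comm (G a1 b1 c1 t)]
    ring
  have hminN : ∀ t, N 0 ≤ N t := by
    intro t
    obtain ⟨e1, o1⟩ := crv_orth X hX t
    obtain ⟨e2, o2⟩ := crv_orth Y hY t
    obtain ⟨e3, o3⟩ := crv_orth Z hZ t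
    have := hmin _ _ _ o1 o2 o3
    rw [e1, e2, e3] at this
    simp only [hN, hG0]
    exact this
  have hloc : IsLocalMin N 0 := Filter.Eventually.of_forall hminN
  have hd0 : deriv N 0 = 0 := hloc.deriv_eq_zero
  have hdN : deriv N = fun t => 2 * trace (G a b c t * G a1 b1 c1 t) := by
    funext t; exact (hN1 t).deriv
  refine ⟨?_, ?_⟩
  · rw [hdN] at hd0
    simp only [hG0] at hd0
    linarith
  · intro hz
    by_contra hneg
    push Not at hneg
    have hdd : deriv (deriv N) 0 = 2 * trace ((a + b - c) * ((X * a1 - a1 * X) + (Y * b1 - b1 * Y) - (Z * c1 - c1 * Z))) := by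
      rw [hdN]
      have := ((hprod a b c a1 b1 c1 0).const_mul 2).deriv
      rw [this]
      simp only [hG0]
      rw [hz]
      simp
    have hlm : IsLocalMax N 0 := isLocalMax_of_deriv_deriv_neg (by rw [hdd]; linarith) hd0
      (hN1 0).continuousAt
    have hev : ∀ᶠ t in nhds (0 : ℝ), N t = N 0 := by
      filter_upwards [hlm] with t ht
      exact le_antisymm ht (hminN t)
    have h1 : N =ᶠ[nhds 0] fun _ => N 0 := hev
    have h2 : deriv N =ᶠ[nhds 0] deriv (fun _ => N 0) := h1.deriv
    have h3 := h2.deriv_eq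
    rw [hdd] at h3
    simp at h3
    rw [h3] at hneg
    exact lt_irrefl _ hneg

end Hessian

end HornHalf
end

section
open Matrix

namespace HornHalf

/-- extension by zero of a function on a set of index pairs to a matrix (pairs are read `(col, row)`) -/
noncomputable def extM {ι K : Type*} [Field K] (P : ι × ι → Prop) [DecidablePred P] :
    ({t // P t} → K) →ₗ[K] Matrix ι ι K where
  toFun ξ := Matrix.of fun i j => if h : P (j, i) then ξ ⟨(j, i), h⟩ else 0
  map_add' x y := by
    ext i j
    simp only [of_apply, Matrix.add_apply]
    split_ifs <;> simp
  map_smul' r x := by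
    ext i j
    simp only [of_apply, Matrix.smul_apply]
    split_ifs <;> simp

theorem extM_apply {ι K : Type*} [Field K] (P : ι × ι → Prop) [DecidablePred P]
    (ξ : {t // P t} → K) (i j : ι) :
    extM P ξ i j = if h : P (j, i) then ξ ⟨(j, i), h⟩ else 0 := rfl

theorem extM_ne {ι K : Type*} [Field K] (P : ι × ι → Prop) [DecidablePred P]
    (ξ : {t // P t} → K) (i j : ι) (h : extM P ξ i j ≠ 0) : P (j, i) := by
  by_contra h'
  exact h (by rw [extM_apply, dif_neg h'])

theorem extM_inj {ι K : Type*} [Field K] (P : ι × ι → Prop) [DecidablePred P]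
    (ξ : {t // P t} → K) (h : extM P ξ = 0) : ξ = 0 := by
  ext ⟨⟨j, i⟩, ht⟩
  have := congrFun (congrFun h i) j
  rw [extM_apply, dif_pos ht] at this
  simpa using this

section
variable {ι : Type*} [Fintype ι] [DecidableEq ι]

theorem trace_quad (K : Matrix ι ι ℝ) (hK : Kᵀ = -K) (δ α : ι → ℝ) :
    trace (diagonal δ * (K * (K * diagonal α - diagonal α * K) - (K * diagonal α - diagonal α * K) * K))
      = - ∑ i, ∑ j, (K i j) ^ 2 * ((δ i - δ j) * (α i - α j)) := by
  have hs : ∀ i j, K j i = - K i j := fun i j => congrFun (congrFun hK i) j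
  have h1 : trace (diagonal δ * (K * (K * diagonal α - diagonal α * K) - (K * diagonal α - diagonal α * K) * K))
      = ∑ i, ∑ j, (K i j) ^ 2 * (- 2 * δ i * (α i - α j)) := by
    have hL : ∀ i j, (K * diagonal α - diagonal α * K) i j = K i j * (α j - α i) := by
      intro i j
      rw [Matrix.sub_apply, mul_diagonal, diagonal_mul]; ring
    generalize K * diagonal α - diagonal α * K = L at hL ⊢
    simp only [trace, diag_apply, diagonal_mul, Matrix.sub_apply, Matrix.mul_apply (M := K),
      Matrix.mul_apply (M := L), hL]
    refine Finset.sum_congr rfl fun i _ => ?_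
    rw [← Finset.sum_sub_distrib, Finset.mul_sum]
    refine Finset.sum_congr rfl fun j _ => ?_
    rw [hs i j]
    ring
  have h2 : ∑ i, ∑ j, (K i j) ^ 2 * (- 2 * δ i * (α i - α j))
      = ∑ i, ∑ j, (K i j) ^ 2 * (- 2 * δ j * (α j - α i)) := by
    rw [Finset.sum_comm]
    refine Finset.sum_congr rfl fun i _ => Finset.sum_congr rfl fun j _ => ?_
    rw [hs i j]; ring
  have h3 : (2:ℝ) * ∑ i, ∑ j, (K i j) ^ 2 * (- 2 * δ i * (α i - α j))
      = 2 * (- ∑ i, ∑ j, (K i j) ^ 2 * ((δ i - δ j) * (α i - α j))) := by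
    rw [two_mul]; nth_rw 2 [h2]
    rw [← Finset.sum_add_distrib, ← Finset.sum_neg_distrib, Finset.mul_sum]
    refine Finset.sum_congr rfl fun i _ => ?_
    rw [← Finset.sum_add_distrib, ← Finset.sum_neg_distrib, Finset.mul_sum]
    refine Finset.sum_congr rfl fun j _ => ?_
    ring
  rw [h1]; linarith

theorem quad_pos (K : Matrix ι ι ℝ) (δ α : ι → ℝ)
    (h : ∀ i j, K i j ≠ 0 → 0 < (δ i - δ j) * (α i - α j)) :
    0 ≤ ∑ i, ∑ j, (K i j) ^ 2 * ((δ i - δ j) * (α i - α j)) ∧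
    (∑ i, ∑ j, (K i j) ^ 2 * ((δ i - δ j) * (α i - α j)) = 0 → K = 0) := by
  have h0 : ∀ i j, 0 ≤ (K i j) ^ 2 * ((δ i - δ j) * (α i - α j)) := by
    intro i j
    by_cases hk : K i j = 0
    · simp [hk]
    · exact mul_nonneg (sq_nonneg _) (h i j hk).le
  refine ⟨Finset.sum_nonneg fun i _ => Finset.sum_nonneg fun j _ => h0 i j, fun hz => ?_⟩
  ext i j
  by_contra hk
  have h1 := (Finset.sum_eq_zero_iff_of_nonneg (fun i _ => Finset.sum_nonneg fun j _ => h0 i j)).1 hz i (Finset.mem_univ _)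
  have h2 := (Finset.sum_eq_zero_iff_of_nonneg (fun j _ => h0 i j)).1 h1 j (Finset.mem_univ _)
  have h3 := mul_pos (sq_pos_of_ne_zero hk) (h i j hk)
  linarith

theorem trace_sq_zero (X : Matrix ι ι ℝ) (h : trace (Xᵀ * X) = 0) : X = 0 := by
  have h1 : ∀ i j, 0 ≤ X i j * X i j := fun i j => mul_self_nonneg _
  simp only [trace, diag_apply, Matrix.mul_apply, transpose_apply] at h
  ext i j
  have h2 := (Finset.sum_eq_zero_iff_of_nonneg (fun j _ => Finset.sum_nonneg fun i _ => h1 i j)).1 h j (Finset.mem_univ _)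
  have h3 := (Finset.sum_eq_zero_iff_of_nonneg (fun i _ => h1 i j)).1 h2 i (Finset.mem_univ _)
  exact mul_self_eq_zero.1 h3

theorem comm_of_first_order (a D : Matrix ι ι ℝ) (ha : a.IsSymm) (hD : D.IsSymm)
    (h : ∀ X : Matrix ι ι ℝ, Xᵀ = -X → trace (D * (X * a - a * X)) = 0) : a * D = D * a := by
  have hX : (a * D - D * a)ᵀ = -(a * D - D * a) := by
    rw [transpose_sub, transpose_mul, transpose_mul, ha.eq, hD.eq]; abel
  have h1 := h _ hX
  have h2 : trace (D * ((a * D - D * a) * a - a * (a * D - D * a)))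
      = - trace ((a * D - D * a)ᵀ * (a * D - D * a)) := by
    rw [hX]
    have e1 : trace (D * ((a * D - D * a) * a)) = trace ((a * D - D * a) * (a * D)) := by
      rw [trace_mul_comm, Matrix.mul_assoc]
    have e2 : trace (D * (a * (a * D - D * a))) = trace ((a * D - D * a) * (D * a)) := by
      rw [← Matrix.mul_assoc, trace_mul_comm]
    rw [Matrix.mul_sub D, trace_sub, e1, e2, ← trace_sub, ← Matrix.mul_sub, Matrix.neg_mul, trace_neg,
      neg_neg]
  rw [h1] at h2
  exact sub_eq_zero.1 (trace_sq_zero _ (by linarith))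

end

end HornHalf
end

section
open Matrix
set_option linter.unusedSectionVars false

namespace HornHalf
section
variable {ι : Type*} [Fintype ι] [DecidableEq ι]

theorem conj_mul {κ : Type*} [Fintype κ] [DecidableEq κ] (U : Matrix ι κ ℝ) (hU : Uᵀ * U = 1) (A B : Matrix κ κ ℝ) :
    (U * A * Uᵀ) * (U * B * Uᵀ) = U * (A * B) * Uᵀ := by
  calc (U * A * Uᵀ) * (U * B * Uᵀ) = U * A * (Uᵀ * U) * B * Uᵀ := by simp only [Matrix.mul_assoc]
    _ = _ := by rw [hU]; simp only [Matrix.mul_assoc, Matrix.mul_one]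

theorem conj_sub {κ : Type*} [Fintype κ] (U : Matrix ι κ ℝ) (A B : Matrix κ κ ℝ) :
    (U * A * Uᵀ) - (U * B * Uᵀ) = U * (A - B) * Uᵀ := by
  rw [Matrix.mul_sub, Matrix.sub_mul]

theorem hess_term (U : Matrix ι ι ℝ) (hU : Uᵀ * U = 1) (δ α : ι → ℝ)
    (hUδ : ∀ i j, δ i ≠ δ j → U i j = 0) (K : Matrix ι ι ℝ) (hK : Kᵀ = -K) (X a : Matrix ι ι ℝ)
    (hX : X = U * K * Uᵀ) (ha : a = U * diagonal α * Uᵀ) :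
    trace (diagonal δ * (X * (X * a - a * X) - (X * a - a * X) * X))
      = - ∑ i, ∑ j, (K i j) ^ 2 * ((δ i - δ j) * (α i - α j)) := by
  have hc : diagonal δ * U = U * diagonal δ := by
    ext i j
    rw [mul_diagonal, diagonal_mul]
    by_cases h : δ i = δ j
    · rw [h]; ring
    · rw [hUδ i j h]; ring
  rw [← trace_quad K hK, hX, ha]
  simp only [conj_mul U hU, conj_sub]
  rw [Matrix.mul_assoc U, ← Matrix.mul_assoc, hc, Matrix.mul_assoc, trace_mul_comm, Matrix.mul_assoc,
    Matrix.mul_assoc, hU, Matrix.mul_one]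

/-- skew-symmetrized extension -/
noncomputable def skE (P : ι × ι → Prop) [DecidablePred P] (U : Matrix ι ι ℝ) (ξ : {t // P t} → ℝ) :
    Matrix ι ι ℝ := U * (extM P ξ - (extM P ξ)ᵀ) * Uᵀ

theorem skew_sub (E : Matrix ι ι ℝ) : (E - Eᵀ)ᵀ = -(E - Eᵀ) := by
  rw [transpose_sub, transpose_transpose]; abel

theorem skE_skew (P : ι × ι → Prop) [DecidablePred P] (U : Matrix ι ι ℝ) (ξ : {t // P t} → ℝ) :
    (skE P U ξ)ᵀ = - skE P U ξ := by
  rw [skE, transpose_mul, transpose_mul, transpose_transpose, skew_sub, Matrix.neg_mul, Matrix.mul_neg,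
    Matrix.mul_assoc]

theorem skE_add (P : ι × ι → Prop) [DecidablePred P] (U : Matrix ι ι ℝ) (ξ η : {t // P t} → ℝ) :
    skE P U (ξ + η) = skE P U ξ + skE P U η := by
  simp only [skE, map_add, transpose_add]
  noncomm_ring

theorem skE_smul (P : ι × ι → Prop) [DecidablePred P] (U : Matrix ι ι ℝ) (r : ℝ) (ξ : {t // P t} → ℝ) :
    skE P U (r • ξ) = r • skE P U ξ := by
  simp only [skE, map_smul, transpose_smul, ← smul_sub, Matrix.mul_smul, Matrix.smul_mul]

theorem off_mul_dg (v : ι → Prop) (A B : Matrix ι ι ℝ) (hA : ∀ i j, (v i ↔ v j) → A i j = 0)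
    (hB : ∀ i j, ¬ (v i ↔ v j) → B i j = 0) :
    ∀ i j, (v i ↔ v j) → (A * B) i j = 0 := by
  intro i j hij
  rw [Matrix.mul_apply]
  refine Finset.sum_eq_zero fun k _ => ?_
  by_cases h : v i ↔ v k
  · rw [hA i k h, zero_mul]
  · rw [hB k j (by tauto), mul_zero]

theorem dg_mul_off (v : ι → Prop) (A B : Matrix ι ι ℝ) (hA : ∀ i j, ¬ (v i ↔ v j) → A i j = 0)
    (hB : ∀ i j, (v i ↔ v j) → B i j = 0) :
    ∀ i j, (v i ↔ v j) → (A * B) i j = 0 := by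
  intro i j hij
  rw [Matrix.mul_apply]
  refine Finset.sum_eq_zero fun k _ => ?_
  by_cases h : v i ↔ v k
  · rw [hB k j (by tauto), mul_zero]
  · rw [hA i k h, zero_mul]

theorem dg_mul_dg (v : ι → Prop) (A B : Matrix ι ι ℝ) (hA : ∀ i j, ¬ (v i ↔ v j) → A i j = 0)
    (hB : ∀ i j, ¬ (v i ↔ v j) → B i j = 0) :
    ∀ i j, ¬ (v i ↔ v j) → (A * B) i j = 0 := by
  intro i j hij
  rw [Matrix.mul_apply]
  refine Finset.sum_eq_zero fun k _ => ?_
  by_cases h : v i ↔ v k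
  · rw [hB k j (by tauto), mul_zero]
  · rw [hA i k h, zero_mul]

theorem comm_symm_off (v : ι → Prop) (U : Matrix ι ι ℝ) (α : ι → ℝ)
    (hUv : ∀ i j, ¬ (v i ↔ v j) → U i j = 0) (P : ι × ι → Prop) [DecidablePred P]
    (hP : ∀ t, P t → v t.1 ∧ ¬ v t.2) (ξ : {t // P t} → ℝ) (a : Matrix ι ι ℝ)
    (ha : a = U * diagonal α * Uᵀ) :
    (skE P U ξ * a - a * skE P U ξ)ᵀ = skE P U ξ * a - a * skE P U ξ ∧
    ∀ i j, (v i ↔ v j) → (skE P U ξ * a - a * skE P U ξ) i j = 0 := by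
  have haT : aᵀ = a := by
    rw [ha, transpose_mul, transpose_mul, transpose_transpose, diagonal_transpose, Matrix.mul_assoc]
  have hUT : ∀ i j, ¬ (v i ↔ v j) → Uᵀ i j = 0 := fun i j h => hUv j i (by tauto)
  have hdiag : ∀ i j, ¬ (v i ↔ v j) → diagonal α i j = 0 := by
    intro i j h
    apply diagonal_apply_ne
    rintro rfl
    exact h Iff.rfl
  have had : ∀ i j, ¬ (v i ↔ v j) → a i j = 0 := by
    rw [ha]; exact dg_mul_dg v _ _ (dg_mul_dg v _ _ hUv hdiag) hUT
  have hE : ∀ i j, (v i ↔ v j) → (extM P ξ - (extM P ξ)ᵀ) i j = 0 := by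
    intro i j h
    rw [Matrix.sub_apply, transpose_apply]
    have h1 : extM P ξ i j = 0 := by
      by_contra h'
      have := hP _ (extM_ne P ξ i j h')
      simp only at this
      tauto
    have h2 : extM P ξ j i = 0 := by
      by_contra h'
      have := hP _ (extM_ne P ξ j i h')
      simp only at this
      tauto
    rw [h1, h2, sub_zero]
  have hX : ∀ i j, (v i ↔ v j) → skE P U ξ i j = 0 :=
    off_mul_dg v _ _ (dg_mul_off v _ _ hUv hE) hUT
  constructor
  · rw [transpose_sub, transpose_mul, transpose_mul, haT, skE_skew]
    simp only [Matrix.mul_neg, Matrix.neg_mul]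
    abel
  · intro i j h
    rw [Matrix.sub_apply, off_mul_dg v _ _ hX had i j h, dg_mul_off v _ _ had hX i j h, sub_zero]

theorem skE_zero (v : ι → Prop) (P : ι × ι → Prop) [DecidablePred P] 
    (hP : ∀ t, P t → v t.1 ∧ ¬ v t.2) (ξ : {t // P t} → ℝ) (h : extM P ξ - (extM P ξ)ᵀ = 0) : ξ = 0 := by
  apply extM_inj
  ext i j
  by_contra h'
  have h1 := extM_ne P ξ i j h'
  have h2 : extM P ξ j i ≠ 0 := by
    have := congrFun (congrFun h i) j
    simp only [Matrix.sub_apply, transpose_apply, Matrix.zero_apply] at this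
    rw [← sub_eq_zero.1 this]; exact h'
  have h3 := hP _ h1
  have h4 := hP _ (extM_ne P ξ j i h2)
  exact h4.2 h3.1

theorem quad_posE (δ α : ι → ℝ) (P : ι × ι → Prop) [DecidablePred P]
    (hP : ∀ t, P t → 0 < δ t.1 ∧ ¬ 0 < δ t.2 ∧ α t.2 < α t.1) (ξ : {t // P t} → ℝ) :
    0 ≤ ∑ i, ∑ j, ((extM P ξ - (extM P ξ)ᵀ) i j) ^ 2 * ((δ i - δ j) * (α i - α j)) ∧
    (∑ i, ∑ j, ((extM P ξ - (extM P ξ)ᵀ) i j) ^ 2 * ((δ i - δ j) * (α i - α j)) = 0 → 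
      ξ = 0) := by
  have := quad_pos (extM P ξ - (extM P ξ)ᵀ) δ α (by
    intro i j h
    rw [Matrix.sub_apply, transpose_apply] at h
    by_cases h1 : extM P ξ i j = 0
    · have h2 : extM P ξ j i ≠ 0 := by
        intro h3; rw [h1, h3] at h; simp at h
      obtain ⟨x, y, z⟩ := hP _ (extM_ne P ξ j i h2)
      simp only at x y z
      exact mul_pos (by linarith) (by linarith)
    · obtain ⟨x, y, z⟩ := hP _ (extM_ne P ξ i j h1)
      simp only at x y z
      exact mul_pos_of_neg_of_neg (by linarith) (by linarith))
  refine ⟨this.1, fun h => skE_zero (fun i => 0 < δ i) P (fun t ht => ⟨(hP t ht).1, (hP t ht).2.1⟩) ξ (this.2 h)⟩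

theorem count_ineq (a b : Matrix ι ι ℝ) (U V : Matrix ι ι ℝ) (α β γ δ : ι → ℝ)
    (hU : Uᵀ * U = 1) (hV : Vᵀ * V = 1)
    (hUδ : ∀ i j, δ i ≠ δ j → U i j = 0) (hVδ : ∀ i j, δ i ≠ δ j → V i j = 0)
    (ha : a = U * diagonal α * Uᵀ) (hb : b = V * diagonal β * Vᵀ)
    (hD : a + b - diagonal γ = diagonal δ)
    (hmin : ∀ O₁ O₂ O₃ : Matrix ι ι ℝ, O₁ᵀ * O₁ = 1 → O₂ᵀ * O₂ = 1 → O₃ᵀ * O₃ = 1 →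
      trace ((a + b - diagonal γ) * (a + b - diagonal γ)) ≤
      trace ((O₁ * a * O₁ᵀ + O₂ * b * O₂ᵀ - O₃ * diagonal γ * O₃ᵀ) *
        (O₁ * a * O₁ᵀ + O₂ * b * O₂ᵀ - O₃ * diagonal γ * O₃ᵀ))) :
    Nat.card {t : ι × ι // 0 < δ t.1 ∧ ¬ 0 < δ t.2 ∧ α t.2 < α t.1} +
    Nat.card {t : ι × ι // 0 < δ t.1 ∧ ¬ 0 < δ t.2 ∧ β t.2 < β t.1} +
    Nat.card {t : ι × ι // 0 < δ t.1 ∧ ¬ 0 < δ t.2 ∧ γ t.1 < γ t.2} ≤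
    Nat.card {t : ι × ι // 0 < δ t.1 ∧ ¬ 0 < δ t.2} := by
  classical
  set Pa : ι × ι → Prop := fun t => 0 < δ t.1 ∧ ¬ 0 < δ t.2 ∧ α t.2 < α t.1 with hPa
  set Pb : ι × ι → Prop := fun t => 0 < δ t.1 ∧ ¬ 0 < δ t.2 ∧ β t.2 < β t.1 with hPb
  set Pc : ι × ι → Prop := fun t => 0 < δ t.1 ∧ ¬ 0 < δ t.2 ∧ γ t.1 < γ t.2 with hPc
  set Pm : ι × ι → Prop := fun t => 0 < δ t.1 ∧ ¬ 0 < δ t.2 with hPm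
  by_contra hlt
  push Not at hlt
  let v : ι → Prop := fun i => 0 < δ i
  have hUv : ∀ i j, ¬ (v i ↔ v j) → U i j = 0 := fun i j h => hUδ i j (fun e => h (by simp only [v, e]))
  have hVv : ∀ i j, ¬ (v i ↔ v j) → V i j = 0 := fun i j h => hVδ i j (fun e => h (by simp only [v, e]))
  have h1v : ∀ i j, ¬ (v i ↔ v j) → (1 : Matrix ι ι ℝ) i j = 0 := by
    intro i j h
    apply one_apply_ne
    rintro rfl
    exact h Iff.rfl
  have h1δ : ∀ i j, δ i ≠ δ j → (1 : Matrix ι ι ℝ) i j = 0 := by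
    intro i j h
    apply one_apply_ne
    rintro rfl
    exact h rfl
  have hc1 : diagonal γ = (1 : Matrix ι ι ℝ) * diagonal γ * 1ᵀ := by simp
  have hPaP : ∀ t, Pa t → v t.1 ∧ ¬ v t.2 := fun t h => ⟨h.1, h.2.1⟩
  have hPbP : ∀ t, Pb t → v t.1 ∧ ¬ v t.2 := fun t h => ⟨h.1, h.2.1⟩
  have hPcP : ∀ t, Pc t → v t.1 ∧ ¬ v t.2 := fun t h => ⟨h.1, h.2.1⟩
  let D1 : ({t // Pa t} → ℝ) × ({t // Pb t} → ℝ) × ({t // Pc t} → ℝ) → Matrix ι ι ℝ := fun ξ =>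
    (skE Pa U ξ.1 * a - a * skE Pa U ξ.1) + (skE Pb V ξ.2.1 * b - b * skE Pb V ξ.2.1)
      - (skE Pc 1 ξ.2.2 * diagonal γ - diagonal γ * skE Pc 1 ξ.2.2)
  let Φ : (({t // Pa t} → ℝ) × ({t // Pb t} → ℝ) × ({t // Pc t} → ℝ)) →ₗ[ℝ] ({t // Pm t} → ℝ) :=
    { toFun := fun ξ t => D1 ξ t.1.2 t.1.1
      map_add' := by
        intro x y
        have : D1 (x + y) = D1 x + D1 y := by
          simp only [D1, Prod.fst_add, Prod.snd_add, skE_add]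
          noncomm_ring
        ext t; simp only [this]; rfl
      map_smul' := by
        intro r x
        have : D1 (r • x) = r • D1 x := by
          simp only [D1, Prod.smul_fst, Prod.smul_snd, skE_smul, Matrix.smul_mul, Matrix.mul_smul, smul_sub, smul_add]
        ext t; simp only [this]; rfl }
  have hker := LinearMap.ker_ne_bot_of_finrank_lt (f := Φ) (by
    simp only [Module.finrank_prod, Module.finrank_fintype_fun_eq_card, ← Nat.card_eq_fintype_card]
    rw [← add_assoc]; exact hlt)
  obtain ⟨ξ, hξ, hξ0⟩ := (Submodule.ne_bot_iff _).1 hker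
  have hD1 : D1 ξ = 0 := by
    have A1 := comm_symm_off v U α hUv Pa hPaP ξ.1 a ha
    have A2 := comm_symm_off v V β hVv Pb hPbP ξ.2.1 b hb
    have A3 := comm_symm_off v 1 γ h1v Pc hPcP ξ.2.2 (diagonal γ) hc1
    have hT : (D1 ξ)ᵀ = D1 ξ := by
      simp only [D1]
      rw [transpose_sub, transpose_add, A1.1, A2.1, A3.1]
    have hO : ∀ i j, (v i ↔ v j) → D1 ξ i j = 0 := by
      intro i j h
      simp only [D1]
      rw [Matrix.sub_apply, Matrix.add_apply, A1.2 i j h, A2.2 i j h, A3.2 i j h]; simp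
    have hm : ∀ i j, v j → ¬ v i → D1 ξ i j = 0 := by
      intro i j hj hi
      exact congrFun (LinearMap.mem_ker.1 hξ) ⟨(j, i), hj, hi⟩
    ext i j
    by_cases hi : v i <;> by_cases hj : v j
    · exact hO i j (by tauto)
    · have := congrFun (congrFun hT i) j
      rw [← this]; exact hm j i hi hj
    · exact hm i j hj hi
    · exact hO i j (by tauto)
  have hso := (second_order a b (diagonal γ) hmin _ _ _ (skE_skew Pa U ξ.1) (skE_skew Pb V ξ.2.1)
    (skE_skew Pc 1 ξ.2.2)).2 hD1
  rw [hD, Matrix.mul_sub, Matrix.mul_add, trace_sub, trace_add,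
    hess_term U hU δ α hUδ _ (skew_sub (extM Pa ξ.1)) (skE Pa U ξ.1) a rfl ha,
    hess_term V hV δ β hVδ _ (skew_sub (extM Pb ξ.2.1)) (skE Pb V ξ.2.1) b rfl hb,
    hess_term 1 (by simp) δ γ h1δ _ (skew_sub (extM Pc ξ.2.2)) (skE Pc 1 ξ.2.2) (diagonal γ) rfl hc1] at hso
  have B1 := quad_posE δ α Pa (fun t h => h) ξ.1
  have B2 := quad_posE δ β Pb (fun t h => h) ξ.2.1
  have B3 := quad_posE δ (-γ) Pc (fun t h => ⟨h.1, h.2.1, by simpa using h.2.2⟩) ξ.2.2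
  have e3 : ∑ i, ∑ j, ((extM Pc ξ.2.2 - (extM Pc ξ.2.2)ᵀ) i j) ^ 2 * ((δ i - δ j) * ((-γ) i - (-γ) j))
     = - ∑ i, ∑ j, ((extM Pc ξ.2.2 - (extM Pc ξ.2.2)ᵀ) i j) ^ 2 * ((δ i - δ j) * (γ i - γ j)) := by
    rw [← Finset.sum_neg_distrib]
    refine Finset.sum_congr rfl fun i _ => ?_
    rw [← Finset.sum_neg_distrib]
    refine Finset.sum_congr rfl fun j _ => ?_
    simp only [Pi.neg_apply]; ring
  rw [e3] at B3
  apply hξ0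
  refine Prod.ext (B1.2 (by linarith)) (Prod.ext (B2.2 (by linarith)) (B3.2 (by linarith)))
end
end HornHalf
end

section
open Matrix
set_option linter.unusedSectionVars false

namespace HornHalf

theorem card_pairs {ι κ : Type*} [Fintype ι] [Fintype κ] (P : ι × κ → Prop) [DecidablePred P] :
    Nat.card {t // P t} = ∑ i, ∑ j, if P (i, j) then 1 else 0 := by
  rw [Nat.card_eq_fintype_card, Fintype.card_subtype, Finset.card_filter, Fintype.sum_prod_type]

open Classical in
theorem rank_exists {p : ℕ} (f : Fin p → ℝ) (hf : Antitone f) (α : Fin p → ℝ) (e : Fin p ≃ Fin p)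
    (he : ∀ i, α i = f (e i)) (v : Fin p → Prop) :
    ∃ ρ : Fin p ≃ Fin p, (∀ i, α i = f (ρ i)) ∧ ∀ i j, v i → ¬ v j → (α i ≤ α j ↔ ρ j < ρ i) := by
  let key : Fin p → Lex (ℝᵒᵈ × ℕ) := fun i => toLex (OrderDual.toDual (α i), if v i then 1 else 0)
  let τ := Tuple.sort key
  have hτ : Monotone (key ∘ τ) := Tuple.monotone_sort key
  have h1 : Monotone ((OrderDual.toDual ∘ α) ∘ τ) := by
    intro i j hij
    have := hτ hij
    rw [Function.comp, Function.comp, Prod.Lex.toLex_le_toLex'] at this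
    exact this.1
  have h2 : Monotone ((OrderDual.toDual ∘ α) ∘ e.symm) := by
    intro i j hij
    simp only [Function.comp, OrderDual.toDual_le_toDual, he, Equiv.apply_symm_apply]
    exact hf hij
  have h3 := Tuple.unique_monotone h1 h2
  have h4 : ∀ i, α (τ i) = f i := by
    intro i
    have := congrFun h3 i
    simp only [Function.comp, he, Equiv.apply_symm_apply] at this
    rw [he]; exact OrderDual.toDual.injective this
  refine ⟨τ.symm, fun i => ?_, fun i j hi hj => ?_⟩
  · rw [← h4, Equiv.apply_symm_apply]
  · constructor
    · intro h
      by_contra hlt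
      push Not at hlt
      have := hτ hlt
      simp only [Function.comp, Equiv.apply_symm_apply, key, Prod.Lex.toLex_le_toLex', if_pos hi, if_neg hj] at this
      have h5 := this.2 (by
        apply congrArg
        apply le_antisymm h
        exact OrderDual.toDual_le_toDual.1 this.1)
      omega
    · intro h
      have := hτ h.le
      simp only [Function.comp, Equiv.apply_symm_apply, key, Prod.Lex.toLex_le_toLex'] at this
      exact this.1

theorem sum_lt_card {p : ℕ} (ρ : Fin p ≃ Fin p) (n : ℕ) (hn : n ≤ p) :
    (∑ j, if (ρ j).1 < n then 1 else 0) = n := by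
  rw [Equiv.sum_comp ρ (fun j => if j.1 < n then 1 else 0), ← Finset.card_filter]
  rcases hn.lt_or_eq with h | h
  · have := Fin.card_Iio (⟨n, h⟩ : Fin p)
    refine Eq.trans ?_ this
    congr 1
    ext j
    simp [Fin.lt_def]
  · subst h
    simp

open Classical in
theorem count_identity {p : ℕ} (ρa ρb : Fin p ≃ Fin p) (v : Fin p → Prop) :
    (∑ i, ∑ j, if v i ∧ ¬ v j ∧ ρb j < ρa i then 1 else 0) +
    (∑ i, ∑ j, if v i ∧ ¬ v j ∧ ρa j ≤ ρb i then 1 else 0) =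
    (∑ i, ∑ j, if v i ∧ ¬ v j ∧ ρa j < ρa i then 1 else 0) +
    (∑ i, ∑ j, if v i ∧ ¬ v j ∧ ρb j < ρb i then 1 else 0) := by
  have split : ∀ (R : Fin p → Fin p → Prop) [∀ i j, Decidable (R i j)],
      (∑ i, ∑ j, if v i ∧ ¬ v j ∧ R i j then 1 else 0) + (∑ i, ∑ j, if v i ∧ v j ∧ R i j then 1 else 0)
        = ∑ i, if v i then (∑ j, if R i j then 1 else 0) else 0 := by
    intro R _
    rw [← Finset.sum_add_distrib]
    refine Finset.sum_congr rfl fun i _ => ?_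
    rw [← Finset.sum_add_distrib]
    by_cases hi : v i
    · simp only [hi, true_and, if_true]
      refine Finset.sum_congr rfl fun j _ => ?_
      by_cases hj : v j <;> simp [hj]
    · simp [hi]
  have s1 := split (fun i j => ρb j < ρa i)
  have s2 := split (fun i j => ρa j ≤ ρb i)
  have s3 := split (fun i j => ρa j < ρa i)
  have s4 := split (fun i j => ρb j < ρb i)
  have c1 : ∀ ρ ρ' : Fin p ≃ Fin p, ∀ i, (∑ j, if ρ j < ρ' i then 1 else 0) = (ρ' i).1 := fun ρ ρ' i =>
    sum_lt_card ρ _ (ρ' i).2.le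
  have c2 : ∀ i, (∑ j, if ρa j ≤ ρb i then 1 else 0) = (ρb i).1 + 1 := by
    intro i
    rw [← sum_lt_card ρa ((ρb i).1 + 1) (ρb i).2]
    refine Finset.sum_congr rfl fun j _ => ?_
    simp only [Fin.le_def, Nat.lt_succ_iff]
  have t1 : (∑ i, ∑ j, if v i ∧ v j ∧ ρb j < ρa i then 1 else 0) + 
      (∑ i, ∑ j, if v i ∧ v j ∧ ρa j ≤ ρb i then 1 else 0) = ∑ i, ∑ j, if v i ∧ v j then 1 else 0 := by
    rw [add_comm, Finset.sum_comm, ← Finset.sum_add_distrib]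
    refine Finset.sum_congr rfl fun i _ => ?_
    rw [← Finset.sum_add_distrib]
    refine Finset.sum_congr rfl fun j _ => ?_
    by_cases hi : v i <;> by_cases hj : v j <;> by_cases h : ρb j < ρa i <;> simp [hi, hj, h, not_le.2, not_lt.1]
  have t2 : ∀ ρ : Fin p ≃ Fin p, (∑ i, ∑ j, if v i ∧ v j ∧ ρ j < ρ i then 1 else 0) + 
      (∑ i, ∑ j, if v i ∧ v j ∧ ρ j < ρ i then 1 else 0) + (∑ i, if v i then 1 else 0)
       = ∑ i, ∑ j, if v i ∧ v j then 1 else 0 := by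
    intro ρ
    conv_lhs => enter [1, 1]; rw [Finset.sum_comm]
    rw [← Finset.sum_add_distrib, ← Finset.sum_add_distrib]
    refine Finset.sum_congr rfl fun i _ => ?_
    have : (if v i then 1 else 0) = ∑ j, if v i ∧ i = j then 1 else 0 := by
      by_cases hi : v i <;> simp [hi]
    rw [this, ← Finset.sum_add_distrib, ← Finset.sum_add_distrib]
    refine Finset.sum_congr rfl fun j _ => ?_
    rcases lt_trichotomy (ρ i) (ρ j) with h | h | h
    · have hne : i ≠ j := by rintro rfl; exact lt_irrefl _ h
      by_cases hi : v i <;> by_cases hj : v j <;> simp [hi, hj, h, h.not_gt, hne]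
    · have := ρ.injective h
      subst this
      by_cases hi : v i <;> simp [hi]
    · have hne : i ≠ j := by rintro rfl; exact lt_irrefl _ h
      by_cases hi : v i <;> by_cases hj : v j <;> simp [hi, hj, h, h.not_gt, hne]
  have u : (∑ i, if v i then (ρb i).1 + 1 else 0) = (∑ i, if v i then (ρb i).1 else 0) + ∑ i, if v i then 1 else 0 := by
    rw [← Finset.sum_add_distrib]
    refine Finset.sum_congr rfl fun i _ => ?_
    by_cases hi : v i <;> simp [hi]
  simp only [c1, c2] at s1 s2 s3 s4
  have := t2 ρa
  have := t2 ρb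
  omega

open Classical in
theorem count_values {p : ℕ} (σ : Fin (2 * p) → ℝ) (hσ : Antitone σ) (α β : Fin p → ℝ)
    (ea eb : Fin p ≃ Fin p) (hα : ∀ i, α i = σ ⟨2 * (ea i).1, by have := (ea i).2; omega⟩)
    (hβ : ∀ i, β i = σ ⟨2 * (eb i).1 + 1, by have := (eb i).2; omega⟩) (v : Fin p → Prop) :
    (∑ i, ∑ j, if v i ∧ ¬ v j ∧ α i ≤ α j then 1 else 0) +
    (∑ i, ∑ j, if v i ∧ ¬ v j ∧ β i ≤ β j then 1 else 0) ≤ 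
    (∑ i, ∑ j, if v i ∧ ¬ v j ∧ α i ≤ β j then 1 else 0) +
    (∑ i, ∑ j, if v i ∧ ¬ v j ∧ β i ≤ α j then 1 else 0) := by
  obtain ⟨ρa, ha, ha'⟩ := rank_exists (fun i : Fin p => σ ⟨2 * i.1, by have := i.2; omega⟩)
    (fun i j h => hσ (by rw [Fin.le_def] at h ⊢; simp only; omega)) α ea hα v
  obtain ⟨ρb, hb, hb'⟩ := rank_exists (fun i : Fin p => σ ⟨2 * i.1 + 1, by have := i.2; omega⟩)
    (fun i j h => hσ (by rw [Fin.le_def] at h ⊢; simp only; omega)) β eb hβ v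
  have e1 : (∑ i, ∑ j, if v i ∧ ¬ v j ∧ α i ≤ α j then 1 else 0) 
    = (∑ i, ∑ j, if v i ∧ ¬ v j ∧ ρa j < ρa i then 1 else 0) := by
    refine Finset.sum_congr rfl fun i _ => Finset.sum_congr rfl fun j _ => ?_
    by_cases hi : v i <;> by_cases hj : v j <;> simp [hi, hj]
    simp only [ha' i j hi hj]
  have e2 : (∑ i, ∑ j, if v i ∧ ¬ v j ∧ β i ≤ β j then 1 else 0) 
    = (∑ i, ∑ j, if v i ∧ ¬ v j ∧ ρb j < ρb i then 1 else 0) := by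
    refine Finset.sum_congr rfl fun i _ => Finset.sum_congr rfl fun j _ => ?_
    by_cases hi : v i <;> by_cases hj : v j <;> simp [hi, hj]
    simp only [hb' i j hi hj]
  rw [e1, e2, ← count_identity]
  have mono : ∀ (R R' : Fin p → Fin p → Prop) [∀ i j, Decidable (R i j)] [∀ i j, Decidable (R' i j)],
      (∀ i j, R i j → R' i j) →
     (∑ i, ∑ j, if v i ∧ ¬ v j ∧ R i j then 1 else 0) ≤ ∑ i, ∑ j, if v i ∧ ¬ v j ∧ R' i j then 1 else 0 := by
    intro R R' _ _ h
    refine Finset.sum_le_sum fun i _ => Finset.sum_le_sum fun j _ => ?_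
    by_cases h1 : v i ∧ ¬ v j ∧ R i j
    · rw [if_pos h1, if_pos ⟨h1.1, h1.2.1, h _ _ h1.2.2⟩]
    · rw [if_neg h1]; exact Nat.zero_le _
  refine add_le_add (mono _ _ fun i j h => ?_) (mono _ _ fun i j h => ?_)
  · rw [ha, hb]
    apply hσ
    rw [Fin.lt_def] at h
    rw [Fin.le_def]; simp only; omega
  · rw [ha, hb]
    apply hσ
    rw [Fin.le_def] at h ⊢; simp only; omega
end HornHalf
end

section
open Matrix
set_option linter.unusedSectionVars false

namespace HornHalf

theorem dim_ineq {p : ℕ} (σ : Fin (2 * p) → ℝ) (hσ : Antitone σ) (α β γ δ : Fin p → ℝ)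
    (ea eb : Fin p ≃ Fin p) (hα : ∀ i, α i = σ ⟨2 * (ea i).1, by have := (ea i).2; omega⟩)
    (hβ : ∀ i, β i = σ ⟨2 * (eb i).1 + 1, by have := (eb i).2; omega⟩)
    (hc : Nat.card {t : Fin p × Fin p // 0 < δ t.1 ∧ ¬ 0 < δ t.2 ∧ α t.2 < α t.1} +
      Nat.card {t : Fin p × Fin p // 0 < δ t.1 ∧ ¬ 0 < δ t.2 ∧ β t.2 < β t.1} +
      Nat.card {t : Fin p × Fin p // 0 < δ t.1 ∧ ¬ 0 < δ t.2 ∧ γ t.1 < γ t.2} ≤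
      Nat.card {t : Fin p × Fin p // 0 < δ t.1 ∧ ¬ 0 < δ t.2}) :
    Nat.card {t : (Fin p ⊕ Fin p) × (Fin p ⊕ Fin p) // 0 < Sum.elim δ δ t.1 ∧ ¬ 0 < Sum.elim δ δ t.2} ≤
    Nat.card {t : Fin p × Fin p // 0 < δ t.1 ∧ ¬ 0 < δ t.2 ∧ γ t.2 ≤ γ t.1} +
    (Nat.card {t : Fin p × Fin p // 0 < δ t.1 ∧ ¬ 0 < δ t.2 ∧ γ t.2 ≤ γ t.1} +
    Nat.card {t : (Fin p ⊕ Fin p) × (Fin p ⊕ Fin p) // 0 < Sum.elim δ δ t.1 ∧ ¬ 0 < Sum.elim δ δ t.2 ∧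
      Sum.elim α β t.1 ≤ Sum.elim α β t.2}) := by
  classical
  have hv := count_values σ hσ α β ea eb hα hβ (fun i => 0 < δ i)
  simp only [card_pairs] at hc ⊢
  simp only [Fintype.sum_sum_type, Sum.elim_inl, Sum.elim_inr, Finset.sum_add_distrib]
  have comp : ∀ f g : Fin p → ℝ, (∑ i, ∑ j, if 0 < δ i ∧ ¬ 0 < δ j then 1 else 0) = 
      (∑ i, ∑ j, if 0 < δ i ∧ ¬ 0 < δ j ∧ f j < g i then 1 else 0) +
      (∑ i, ∑ j, if 0 < δ i ∧ ¬ 0 < δ j ∧ g i ≤ f j then 1 else 0) := by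
    intro f g
    rw [← Finset.sum_add_distrib]
    refine Finset.sum_congr rfl fun i _ => ?_
    rw [← Finset.sum_add_distrib]
    refine Finset.sum_congr rfl fun j _ => ?_
    by_cases hi : 0 < δ i <;> by_cases hj : 0 < δ j <;> by_cases h : f j < g i <;>
      simp [hi, hj, h, not_lt.1, not_le.2]
  have comp' : (∑ i, ∑ j, if 0 < δ i ∧ ¬ 0 < δ j then 1 else 0) = 
      (∑ i, ∑ j, if 0 < δ i ∧ ¬ 0 < δ j ∧ γ i < γ j then 1 else 0) +
      (∑ i, ∑ j, if 0 < δ i ∧ ¬ 0 < δ j ∧ γ j ≤ γ i then 1 else 0) := by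
    rw [← Finset.sum_add_distrib]
    refine Finset.sum_congr rfl fun i _ => ?_
    rw [← Finset.sum_add_distrib]
    refine Finset.sum_congr rfl fun j _ => ?_
    by_cases hi : 0 < δ i <;> by_cases hj : 0 < δ j <;> by_cases h : γ i < γ j <;>
      simp [hi, hj, h, not_lt.1, not_le.2]
  have a1 := comp α α
  have a2 := comp β β
  have key : (∑ i, ∑ j, if 0 < δ i ∧ ¬ 0 < δ j then 1 else 0) + (∑ i, ∑ j, if 0 < δ i ∧ ¬ 0 < δ j then 1 else 0) + ((∑ i, ∑ j, if 0 < δ i ∧ ¬ 0 < δ j then 1 else 0) + (∑ i, ∑ j, if 0 < δ i ∧ ¬ 0 < δ j then 1 else 0)) ≤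
      (∑ i, ∑ j, if 0 < δ i ∧ ¬ 0 < δ j ∧ γ j ≤ γ i then 1 else 0) + ((∑ i, ∑ j, if 0 < δ i ∧ ¬ 0 < δ j ∧ γ j ≤ γ i then 1 else 0) +
      ((∑ i, ∑ j, if 0 < δ i ∧ ¬ 0 < δ j ∧ α i ≤ α j then 1 else 0) + (∑ i, ∑ j, if 0 < δ i ∧ ¬ 0 < δ j ∧ β i ≤ α j then 1 else 0) +
      ((∑ i, ∑ j, if 0 < δ i ∧ ¬ 0 < δ j ∧ α i ≤ β j then 1 else 0) + (∑ i, ∑ j, if 0 < δ i ∧ ¬ 0 < δ j ∧ β i ≤ β j then 1 else 0)))) := by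
    omega
  convert key <;> exact if_congr Iff.rfl rfl rfl

section
variable {κ : Type*} [Fintype κ] [DecidableEq κ]

theorem trace_comm_diag (Q : Matrix κ κ ℂ) (s : κ → ℝ) :
    trace (Qᴴ * (diagonal (fun k => (s k : ℂ)) * Q - Q * diagonal (fun k => (s k : ℂ)))) =
      ((∑ l, ∑ k, ‖Q k l‖ ^ 2 * (s k - s l) : ℝ) : ℂ) := by
  have hL : ∀ k l, (diagonal (fun k => (s k : ℂ)) * Q - Q * diagonal (fun k => (s k : ℂ))) k l
      = Q k l * (s k - s l) := by
    intro k l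
    rw [Matrix.sub_apply, mul_diagonal, diagonal_mul]; ring
  generalize (diagonal (fun k => (s k : ℂ)) * Q - Q * diagonal (fun k => (s k : ℂ))) = L at hL ⊢
  simp only [trace, diag_apply, Matrix.mul_apply, conjTranspose_apply, hL]
  push_cast
  refine Finset.sum_congr rfl fun l _ => Finset.sum_congr rfl fun k _ => ?_
  rw [← mul_assoc, ← Complex.conj_mul']
  rfl

theorem tr_conj (𝓤 : Matrix κ κ ℂ) (h𝓤 : 𝓤ᴴ * 𝓤 = 1) (Q S : Matrix κ κ ℂ) :
    trace ((𝓤 * Q * 𝓤ᴴ)ᴴ * ((𝓤 * S * 𝓤ᴴ) * (𝓤 * Q * 𝓤ᴴ) - (𝓤 * Q * 𝓤ᴴ) * (𝓤 * S * 𝓤ᴴ)))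
      = trace (Qᴴ * (S * Q - Q * S)) := by
  have hm : ∀ A B : Matrix κ κ ℂ, (𝓤 * A * 𝓤ᴴ) * (𝓤 * B * 𝓤ᴴ) = 𝓤 * (A * B) * 𝓤ᴴ := by
    intro A B
    calc (𝓤 * A * 𝓤ᴴ) * (𝓤 * B * 𝓤ᴴ) = 𝓤 * A * (𝓤ᴴ * 𝓤) * B * 𝓤ᴴ := by simp only [Matrix.mul_assoc]
      _ = _ := by rw [h𝓤]; simp only [Matrix.mul_assoc, Matrix.mul_one]
  have hT : (𝓤 * Q * 𝓤ᴴ)ᴴ = 𝓤 * Qᴴ * 𝓤ᴴ := by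
    rw [conjTranspose_mul, conjTranspose_mul, conjTranspose_conjTranspose, Matrix.mul_assoc]
  rw [hT, hm, hm, ← Matrix.sub_mul, ← Matrix.mul_sub, hm, trace_mul_comm, ← Matrix.mul_assoc, h𝓤, Matrix.one_mul]

/-- the positivity argument -/
theorem positivity_core (v : κ → Prop) (𝓤 J : Matrix κ κ ℂ) (s γ δ : κ → ℝ) (h𝓤 : 𝓤ᴴ * 𝓤 = 1) (hJ : Jᴴ * J = 1)
    (hv : ∀ k, v k ↔ 0 < δ k)
    (hS : 𝓤 * diagonal (fun k => (s k : ℂ)) * 𝓤ᴴ + Jᴴ * (𝓤 * diagonal (fun k => (s k : ℂ)) * 𝓤ᴴ) * J =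
      diagonal (fun k => ((γ k + δ k : ℝ) : ℂ)))
    (g Q : Matrix κ κ ℂ) (hgJ : g * J = J * g) (hgQ : g = 𝓤 * Q * 𝓤ᴴ)
    (hg : ∀ k l, g k l ≠ 0 → ¬ v k ∧ v l ∧ γ k ≤ γ l)
    (hQ : ∀ k l, Q k l ≠ 0 → s l ≤ s k) : g = 0 := by
  have hJ' := mul_eq_one_comm.1 hJ
  set S0 := 𝓤 * diagonal (fun k => (s k : ℂ)) * 𝓤ᴴ with hS0
  have h1 : trace (gᴴ * (S0 * g - g * S0)) = ((∑ l, ∑ k, ‖Q k l‖ ^ 2 * (s k - s l) : ℝ) : ℂ) := by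
    rw [hS0, hgQ, tr_conj 𝓤 h𝓤, trace_comm_diag]
  have h2 : trace (gᴴ * (diagonal (fun k => ((γ k + δ k : ℝ) : ℂ)) * g - g * diagonal (fun k => ((γ k + δ k : ℝ) : ℂ))))
     = ((∑ l, ∑ k, ‖g k l‖ ^ 2 * ((γ k + δ k) - (γ l + δ l)) : ℝ) : ℂ) := trace_comm_diag g (fun k => γ k + δ k)
  have h3 : trace (gᴴ * (Jᴴ * S0 * J * g - g * (Jᴴ * S0 * J))) = trace (gᴴ * (S0 * g - g * S0)) := by
    have hgg : g = Jᴴ * g * Jᴴᴴ := by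
      rw [conjTranspose_conjTranspose, Matrix.mul_assoc, hgJ, ← Matrix.mul_assoc, hJ, Matrix.one_mul]
    have := tr_conj Jᴴ (by rw [conjTranspose_conjTranspose]; exact hJ') g S0
    rw [← hgg, conjTranspose_conjTranspose] at this
    exact this
  have h4 : (∑ l, ∑ k, ‖g k l‖ ^ 2 * ((γ k + δ k) - (γ l + δ l)) : ℝ) = 2 * (∑ l, ∑ k, ‖Q k l‖ ^ 2 * (s k - s l) : ℝ) := by
    have : ((∑ l, ∑ k, ‖g k l‖ ^ 2 * ((γ k + δ k) - (γ l + δ l)) : ℝ) : ℂ) = ((2 * (∑ l, ∑ k, ‖Q k l‖ ^ 2 * (s k - s l) : ℝ) : ℝ) : ℂ) := by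
      rw [← h2, ← hS]
      push_cast
      push_cast at h1
      rw [← h1, two_mul]
      nth_rw 2 [← h3]
      rw [← trace_add]
      congr 1
      noncomm_ring
    exact_mod_cast this
  have h5 : 0 ≤ (∑ l, ∑ k, ‖Q k l‖ ^ 2 * (s k - s l) : ℝ) := by
    refine Finset.sum_nonneg fun l _ => Finset.sum_nonneg fun k _ => ?_
    by_cases h : Q k l = 0
    · simp [h]
    · exact mul_nonneg (by positivity) (by linarith [hQ k l h])
  have h6 : ∀ l k, g k l ≠ 0 → ‖g k l‖ ^ 2 * ((γ k + δ k) - (γ l + δ l)) < 0 := by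
    intro l k h
    obtain ⟨x, y, z⟩ := hg k l h
    rw [hv] at x y
    exact mul_neg_of_pos_of_neg (pow_pos (norm_pos_iff.2 h) 2) (by linarith)
  have h7 : ∀ l k, ‖g k l‖ ^ 2 * ((γ k + δ k) - (γ l + δ l)) ≤ 0 := by
    intro l k
    by_cases h : g k l = 0
    · simp [h]
    · exact (h6 l k h).le
  have h8 : (∑ l, ∑ k, ‖g k l‖ ^ 2 * ((γ k + δ k) - (γ l + δ l)) : ℝ) = 0 :=
    le_antisymm (Finset.sum_nonpos fun l _ => Finset.sum_nonpos fun k _ => h7 l k) (by rw [h4]; linarith)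
  ext k l
  by_contra h
  have e1 := (Finset.sum_eq_zero_iff_of_nonpos (fun l _ => Finset.sum_nonpos fun k _ => h7 l k)).1 h8 l (Finset.mem_univ _)
  have e2 := (Finset.sum_eq_zero_iff_of_nonpos (fun k _ => h7 l k)).1 e1 k (Finset.mem_univ _)
  exact absurd e2 (h6 l k h).ne

end

end HornHalf
end

section
open Matrix
set_option linter.unusedSectionVars false

namespace HornHalf
section
variable {ι : Type*} [Fintype ι] [DecidableEq ι]

/-- the standard complex structure -/
def J0 (ι R : Type*) [DecidableEq ι] [CommRing R] : Matrix (ι ⊕ ι) (ι ⊕ ι) R := fromBlocks 0 (-1) 1 0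

theorem J0_unit : (J0 ι ℂ)ᴴ * J0 ι ℂ = 1 := by
  rw [J0, fromBlocks_conjTranspose, fromBlocks_multiply, ← fromBlocks_one]
  simp

theorem J0_supp (v : ι → Prop) (k l : ι ⊕ ι) (h : ¬ (Sum.elim v v k ↔ Sum.elim v v l)) : J0 ι ℂ k l = 0 := by
  rcases k with k | k <;> rcases l with l | l <;> simp only [Sum.elim_inl, Sum.elim_inr] at h <;>
   simp [J0, Matrix.one_apply]
  · rintro rfl; exact h Iff.rfl
  · rintro rfl; exact h Iff.rfl

/-- matrices commuting with `J0` -/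
def gm (G : Matrix ι ι ℂ × Matrix ι ι ℂ) : Matrix (ι ⊕ ι) (ι ⊕ ι) ℂ := fromBlocks G.1 (-G.2) G.2 G.1

theorem gm_comm (G : Matrix ι ι ℂ × Matrix ι ι ℂ) : gm G * J0 ι ℂ = J0 ι ℂ * gm G := by
  rw [gm, J0, fromBlocks_multiply, fromBlocks_multiply]
  simp

theorem gm_supp (G : Matrix ι ι ℂ × Matrix ι ι ℂ) (R : ι → ι → Prop) (h1 : ∀ i j, G.1 i j ≠ 0 → R i j)
    (h2 : ∀ i j, G.2 i j ≠ 0 → R i j) (k l : ι ⊕ ι) (h : gm G k l ≠ 0) :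
    R (Sum.elim id id k) (Sum.elim id id l) := by
  rcases k with k | k <;> rcases l with l | l <;> simp only [gm, fromBlocks_apply₁₁, fromBlocks_apply₁₂,
    fromBlocks_apply₂₁, fromBlocks_apply₂₂, Matrix.neg_apply, neg_ne_zero] at h
  · exact h1 _ _ h
  · exact h2 _ _ h
  · exact h2 _ _ h
  · exact h1 _ _ h

theorem conj_supp {κ : Type*} [Fintype κ] (v : κ → Prop) (𝓤 Q : Matrix κ κ ℂ)
    (h𝓤 : ∀ k l, ¬ (v k ↔ v l) → 𝓤 k l = 0)
    (hQ : ∀ k l, Q k l ≠ 0 → ¬ v k ∧ v l) (k l : κ) (h : (𝓤 * Q * 𝓤ᴴ) k l ≠ 0) : ¬ v k ∧ v l := by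
  rw [Matrix.mul_apply] at h
  obtain ⟨m, _, hm⟩ := Finset.exists_ne_zero_of_sum_ne_zero h
  have h1 := left_ne_zero_of_mul hm
  have h2 := right_ne_zero_of_mul hm
  rw [Matrix.mul_apply] at h1
  obtain ⟨n, _, hn⟩ := Finset.exists_ne_zero_of_sum_ne_zero h1
  have h3 := left_ne_zero_of_mul hn
  have h4 := right_ne_zero_of_mul hn
  have a1 : v k ↔ v n := by by_contra h; exact h3 (h𝓤 _ _ h)
  have a2 : v l ↔ v m := by
    by_contra h
    apply h2
    rw [conjTranspose_apply, h𝓤 _ _ h, star_zero]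
  have a3 := hQ _ _ h4
  tauto

theorem transversality (𝓤 : Matrix (ι ⊕ ι) (ι ⊕ ι) ℂ) (s : ι ⊕ ι → ℝ) (γ δ : ι → ℝ) (h𝓤 : 𝓤ᴴ * 𝓤 = 1)
    (h𝓤v : ∀ k l, ¬ (0 < Sum.elim δ δ k ↔ 0 < Sum.elim δ δ l) → 𝓤 k l = 0)
    (hS : 𝓤 * diagonal (fun k => (s k : ℂ)) * 𝓤ᴴ +
      (J0 ι ℂ)ᴴ * (𝓤 * diagonal (fun k => (s k : ℂ)) * 𝓤ᴴ) * J0 ι ℂ =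
      diagonal (fun k => ((Sum.elim γ γ k + Sum.elim δ δ k : ℝ) : ℂ)))
    (hdim : Nat.card {t : (ι ⊕ ι) × (ι ⊕ ι) // 0 < Sum.elim δ δ t.1 ∧ ¬ 0 < Sum.elim δ δ t.2} ≤
      Nat.card {t : ι × ι // 0 < δ t.1 ∧ ¬ 0 < δ t.2 ∧ γ t.2 ≤ γ t.1} +
      (Nat.card {t : ι × ι // 0 < δ t.1 ∧ ¬ 0 < δ t.2 ∧ γ t.2 ≤ γ t.1} +
      Nat.card {t : (ι ⊕ ι) × (ι ⊕ ι) // 0 < Sum.elim δ δ t.1 ∧ ¬ 0 < Sum.elim δ δ t.2 ∧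
        s t.1 ≤ s t.2}))
    (M : Matrix (ι ⊕ ι) (ι ⊕ ι) ℂ) :
    ∃ g π q : Matrix (ι ⊕ ι) (ι ⊕ ι) ℂ, M = g + π + q ∧
      (g * J0 ι ℂ = J0 ι ℂ * g ∧ ∀ k l, g k l ≠ 0 → Sum.elim γ γ k ≤ Sum.elim γ γ l) ∧
      (∀ k l, π k l ≠ 0 → 0 < Sum.elim δ δ l → 0 < Sum.elim δ δ k) ∧
      (∀ k l, (𝓤ᴴ * q * 𝓤) k l ≠ 0 → s l ≤ s k) := by
  classical
  set Pc : ι × ι → Prop := fun t => 0 < δ t.1 ∧ ¬ 0 < δ t.2 ∧ γ t.2 ≤ γ t.1 with hPc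
  set PF : (ι ⊕ ι) × (ι ⊕ ι) → Prop := fun t => 0 < Sum.elim δ δ t.1 ∧ ¬ 0 < Sum.elim δ δ t.2 ∧
        s t.1 ≤ s t.2 with hPF
  set Pm : (ι ⊕ ι) × (ι ⊕ ι) → Prop := fun t => 0 < Sum.elim δ δ t.1 ∧ ¬ 0 < Sum.elim δ δ t.2 with hPm
  let v : ι ⊕ ι → Prop := fun k => 0 < Sum.elim δ δ k
  let gg : (({t // Pc t} → ℂ) × ({t // Pc t} → ℂ) × ({t // PF t} → ℂ)) → Matrix (ι ⊕ ι) (ι ⊕ ι) ℂ := fun ξ => gm (extM Pc ξ.1, extM Pc ξ.2.1)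
  let qq : (({t // Pc t} → ℂ) × ({t // Pc t} → ℂ) × ({t // PF t} → ℂ)) → Matrix (ι ⊕ ι) (ι ⊕ ι) ℂ := fun ξ => 𝓤 * extM PF ξ.2.2 * 𝓤ᴴ
  have gadd : ∀ x y, gg (x + y) = gg x + gg y := by
    intro x y
    simp only [gg, gm, Prod.fst_add, Prod.snd_add, map_add, fromBlocks_add, neg_add]
  have gsmul : ∀ (r : ℂ) x, gg (r • x) = r • gg x := by
    intro r x
    simp only [gg, gm, Prod.smul_fst, Prod.smul_snd, map_smul, fromBlocks_smul, smul_neg]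
  have qadd : ∀ x y, qq (x + y) = qq x + qq y := by
    intro x y
    simp only [qq, Prod.snd_add, map_add, Matrix.mul_add, Matrix.add_mul]
  have qsmul : ∀ (r : ℂ) x, qq (r • x) = r • qq x := by
    intro r x
    simp only [qq, Prod.smul_snd, map_smul, Matrix.mul_smul, Matrix.smul_mul]
  let Φ : (({t // Pc t} → ℂ) × ({t // Pc t} → ℂ) × ({t // PF t} → ℂ)) →ₗ[ℂ] ({t // Pm t} → ℂ) :=
    { toFun := fun ξ t => (gg ξ + qq ξ) t.1.2 t.1.1
      map_add' := by
        intro x y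
        ext t
        simp only [gadd, qadd, Matrix.add_apply, Pi.add_apply]; ring
      map_smul' := by
        intro r x
        ext t
        simp only [gsmul, qsmul, Matrix.add_apply, Matrix.smul_apply, Pi.smul_apply, smul_add, RingHom.id_apply] }
  have gcomm : ∀ ξ, gg ξ * J0 ι ℂ = J0 ι ℂ * gg ξ := fun ξ => gm_comm _
  have gsupp : ∀ ξ k l, gg ξ k l ≠ 0 → ¬ v k ∧ v l ∧ Sum.elim γ γ k ≤ Sum.elim γ γ l := by
    intro ξ k l h
    have := gm_supp _ (fun i j => Pc (j, i)) (extM_ne Pc ξ.1) (extM_ne Pc ξ.2.1) k l h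
    simp only [Pc] at this
    have hE : ∀ (f : ι → ℝ) k, f (Sum.elim id id k) = Sum.elim f f k := by
      rintro f (k | k) <;> rfl
    simp only [hE] at this
    exact ⟨this.2.1, this.1, this.2.2⟩
  have Qsupp : ∀ (ξ : {t // PF t} → ℂ) k l, extM PF ξ k l ≠ 0 → ¬ v k ∧ v l ∧ s l ≤ s k := by
    intro ξ k l h
    obtain ⟨x, y, z⟩ := extM_ne PF ξ k l h
    exact ⟨y, x, z⟩
  have qsupp : ∀ ξ k l, qq ξ k l ≠ 0 → ¬ v k ∧ v l := fun ξ k l h =>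
    conj_supp v 𝓤 _ h𝓤v (fun k l h => ⟨(Qsupp _ k l h).1, (Qsupp _ k l h).2.1⟩) k l h
  have hinj : Function.Injective Φ := by
    rw [injective_iff_map_eq_zero]
    intro ξ hξ
    have h0 : gg ξ + qq ξ = 0 := by
      ext k l
      by_cases h : ¬ v k ∧ v l
      · exact congrFun hξ ⟨(l, k), h.2, h.1⟩
      · have h1 : gg ξ k l = 0 := by
          by_contra h'
          exact h ⟨(gsupp ξ k l h').1, (gsupp ξ k l h').2.1⟩
        have h2 : qq ξ k l = 0 := by
          by_contra h'
          exact h (qsupp ξ k l h')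
        simp [h1, h2]
    have h1 : gg ξ = 𝓤 * (-(extM PF ξ.2.2)) * 𝓤ᴴ := by
      rw [Matrix.mul_neg, Matrix.neg_mul]
      exact eq_neg_of_add_eq_zero_left h0
    have hg0 := positivity_core v 𝓤 (J0 ι ℂ) s (Sum.elim γ γ) (Sum.elim δ δ) h𝓤 J0_unit (fun k => Iff.rfl) hS (gg ξ) _
      (gcomm ξ) h1 (gsupp ξ) (by
        intro k l h
        rw [Matrix.neg_apply, neg_ne_zero] at h
        exact (Qsupp _ k l h).2.2)
    have hQ0 : extM PF ξ.2.2 = 0 := by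
      rw [hg0] at h1
      have : 𝓤ᴴ * (𝓤 * (-(extM PF ξ.2.2)) * 𝓤ᴴ) * 𝓤 = -(extM PF ξ.2.2) := by
        calc 𝓤ᴴ * (𝓤 * (-(extM PF ξ.2.2)) * 𝓤ᴴ) * 𝓤 = (𝓤ᴴ * 𝓤) * (-(extM PF ξ.2.2)) * (𝓤ᴴ * 𝓤) := by
              simp only [Matrix.mul_assoc]
          _ = _ := by rw [h𝓤]; simp
      rw [← h1] at this
      simpa using this.symm
    have hG : fromBlocks (extM Pc ξ.1) (-(extM Pc ξ.2.1)) (extM Pc ξ.2.1) (extM Pc ξ.1) = fromBlocks 0 0 0 0 := by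
      rw [fromBlocks_zero]; exact hg0
    rw [fromBlocks_inj] at hG
    exact Prod.ext (extM_inj _ _ hG.1) (Prod.ext (extM_inj _ _ hG.2.2.1) (extM_inj _ _ hQ0))
  have hfin : Module.finrank ℂ (({t // Pc t} → ℂ) × ({t // Pc t} → ℂ) × ({t // PF t} → ℂ)) = Module.finrank ℂ ({t // Pm t} → ℂ) := by
    apply le_antisymm (LinearMap.finrank_le_finrank_of_injective hinj)
    simp only [Module.finrank_prod, Module.finrank_fintype_fun_eq_card, ← Nat.card_eq_fintype_card]
    exact hdim
  have hsurj := (LinearMap.injective_iff_surjective_of_finrank_eq_finrank hfin).1 hinj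
  obtain ⟨ξ, hξ⟩ := hsurj (fun t => M t.1.2 t.1.1)
  refine ⟨gg ξ, M - gg ξ - qq ξ, qq ξ, by abel, ⟨gcomm ξ, fun k l h => (gsupp ξ k l h).2.2⟩, ?_, ?_⟩
  · intro k l h hl
    by_contra hk
    apply h
    have := congrFun hξ ⟨(l, k), hl, hk⟩
    have e : gg ξ k l + qq ξ k l = M k l := this
    simp only [Matrix.sub_apply]
    rw [← e]; ring
  · have e : 𝓤ᴴ * qq ξ * 𝓤 = extM PF ξ.2.2 := by
      calc 𝓤ᴴ * qq ξ * 𝓤 = (𝓤ᴴ * 𝓤) * extM PF ξ.2.2 * (𝓤ᴴ * 𝓤) := by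
              simp only [qq, Matrix.mul_assoc]
          _ = _ := by rw [h𝓤]; simp
    rw [e]
    exact fun k l h => (Qsupp _ k l h).2.2
end
end HornHalf
end

section
open Matrix
set_option linter.unusedSectionVars false

namespace HornHalf
section
variable {R : Type*} [NormedRing R] [NormedAlgebra ℂ R] [FiniteDimensional ℂ R] [CompleteSpace R]

theorem local_dec_abs (B1 B2 B3 : Submodule ℂ (R)) (h1 : (1 : R) ∈ B1)
    (h2 : (1 : R) ∈ B2) (h3 : (1 : R) ∈ B3)
    (h : ∀ M, ∃ x ∈ B1, ∃ y ∈ B2, ∃ z ∈ B3, M = x + y + z) (N : R) :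
    ∀ᶠ z in nhds (0 : ℂ), ∃ x ∈ B1, ∃ y ∈ B2, ∃ w ∈ B3, IsUnit x ∧ IsUnit y ∧ IsUnit w ∧
      1 + z • N = x * y * w := by
  let f : B1 × B2 × B3 → R := fun t => (1 + (t.1 : R)) * (1 + (t.2.1 : R)) *
    (1 + (t.2.2 : R))
  let L1 : B1 × B2 × B3 →L[ℂ] R := B1.subtypeL.comp (ContinuousLinearMap.fst ℂ B1 (B2 × B3))
  let L2 : B1 × B2 × B3 →L[ℂ] R := B2.subtypeL.comp
    ((ContinuousLinearMap.fst ℂ B2 B3).comp (ContinuousLinearMap.snd ℂ B1 (B2 × B3)))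
  let L3 : B1 × B2 × B3 →L[ℂ] R := B3.subtypeL.comp
    ((ContinuousLinearMap.snd ℂ B2 B3).comp (ContinuousLinearMap.snd ℂ B1 (B2 × B3)))
  have hf : HasStrictFDerivAt f (L1 + L2 + L3) 0 := by
    have a1 : HasStrictFDerivAt (fun t => 1 + L1 t) L1 0 := L1.hasStrictFDerivAt.const_add 1
    have a2 : HasStrictFDerivAt (fun t => 1 + L2 t) L2 0 := L2.hasStrictFDerivAt.const_add 1
    have a3 : HasStrictFDerivAt (fun t => 1 + L3 t) L3 0 := L3.hasStrictFDerivAt.const_add 1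
    have := (a1.mul' a2).mul' a3
    refine this.congr_fderiv ?_
    refine ContinuousLinearMap.ext fun t => ?_
    change ((1 + L1 0) * (1 + L2 0)) * L3 t + ((1 + L1 0) * L2 t + L1 t * (1 + L2 0)) * (1 + L3 0) =
      L1 t + L2 t + L3 t
    simp only [map_zero, add_zero, one_mul, mul_one]
    abel
  have hf0 : f 0 = 1 := by simp [f]
  have hsurj : (L1 + L2 + L3).range = ⊤ := by
    rw [LinearMap.range_eq_top]
    intro M
    obtain ⟨x, hx, y, hy, z, hz, rfl⟩ := h M
    exact ⟨(⟨x, hx⟩, ⟨y, hy⟩, ⟨z, hz⟩), rfl⟩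
  have hmap := hf.map_nhds_eq_of_surj hsurj
  rw [hf0] at hmap
  have hU : ∀ᶠ t in nhds (0 : B1 × B2 × B3), IsUnit (1 + L1 t) ∧ IsUnit (1 + L2 t) ∧ IsUnit (1 + L3 t) := by
    have : ∀ L : B1 × B2 × B3 →L[ℂ] R, ∀ᶠ t in nhds (0 : B1 × B2 × B3), IsUnit (1 + L t) := by
      intro L
      have hc : ContinuousAt (fun t => 1 + L t) 0 := (continuous_const.add L.continuous).continuousAt
      apply hc.eventually
      simp only [map_zero, add_zero]
      exact Units.nhds (1 : (R)ˣ)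
    exact (this L1).and ((this L2).and (this L3))
  have hev : ∀ᶠ M in Filter.map f (nhds 0), ∃ x ∈ B1, ∃ y ∈ B2, ∃ w ∈ B3, IsUnit x ∧ IsUnit y ∧ IsUnit w ∧
      M = x * y * w := by
    rw [Filter.eventually_map]
    filter_upwards [hU] with t ht
    exact ⟨_, B1.add_mem h1 t.1.2, _, B2.add_mem h2 t.2.1.2, _, B3.add_mem h3 t.2.2.2, ht.1, ht.2.1, ht.2.2, rfl⟩
  have hc : Filter.Tendsto (fun z : ℂ => 1 + z • N) (nhds 0) (Filter.map f (nhds 0)) := by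
    rw [hmap]
    have : ContinuousAt (fun z : ℂ => 1 + z • N) 0 :=
      (continuous_const.add (continuous_id.smul continuous_const)).continuousAt
    have h' := this.tendsto
    simp only [zero_smul, add_zero] at h'
    exact h'
  exact hc.eventually hev
end

section
attribute [local instance] Matrix.linftyOpNormedRing Matrix.linftyOpNormedAlgebra
theorem local_dec {κ : Type*} [Fintype κ] [DecidableEq κ]
    (B1 B2 B3 : Submodule ℂ (Matrix κ κ ℂ)) (h1 : (1 : Matrix κ κ ℂ) ∈ B1)
    (h2 : (1 : Matrix κ κ ℂ) ∈ B2) (h3 : (1 : Matrix κ κ ℂ) ∈ B3)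
    (h : ∀ M, ∃ x ∈ B1, ∃ y ∈ B2, ∃ z ∈ B3, M = x + y + z) (N : Matrix κ κ ℂ) :
    ∀ᶠ z in nhds (0 : ℂ), ∃ x ∈ B1, ∃ y ∈ B2, ∃ w ∈ B3, IsUnit x ∧ IsUnit y ∧ IsUnit w ∧
      1 + z • N = x * y * w := by
  have : CompleteSpace (Matrix κ κ ℂ) := FiniteDimensional.complete ℂ _
  exact local_dec_abs B1 B2 B3 h1 h2 h3 h N
end
end HornHalf
end

section
open Matrix
set_option linter.unusedSectionVars false

namespace HornHalf

theorem exists_field_aut {k : Type*} [Field k] [Algebra k ℂ] (z0 z1 : ℂ)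
    (h0 : Transcendental k z0) (h1 : Transcendental k z1) :
    ∃ τ : ℂ ≃+* ℂ, (∀ x : k, τ (algebraMap k ℂ x) = algebraMap k ℂ x) ∧ τ z0 = z1 := by
  have hs : ∀ z : ℂ, Transcendental k z → AlgebraicIndepOn k id ({z} : Set ℂ) := by
    intro z hz
    have : AlgebraicIndependent k (fun i : ({z} : Set ℂ) => (i : ℂ)) := by
      rw [algebraicIndependent_unique_type_iff]
      exact hz
    exact this
  obtain ⟨B0, hz0, hB0⟩ := exists_isTranscendenceBasis_superset (hs z0 h0)
  obtain ⟨B1, hz1, hB1⟩ := exists_isTranscendenceBasis_superset (hs z1 h1)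
  have hc := hB0.cardinalMk_eq hB1
  obtain ⟨e0⟩ := Cardinal.eq.1 hc
  let i0 : B0 := ⟨z0, hz0 rfl⟩
  let i1 : B1 := ⟨z1, hz1 rfl⟩
  let e : B0 ≃ B1 := e0.trans (Equiv.swap (e0 i0) i1)
  have he : e i0 = i1 := by simp [e]
  letI := IsAlgClosed.isAlgClosure_of_transcendence_basis _ hB0
  letI := IsAlgClosed.isAlgClosure_of_transcendence_basis _ hB1
  let E : Algebra.adjoin k (Set.range ((↑) : B0 → ℂ)) ≃ₐ[k] Algebra.adjoin k (Set.range ((↑) : B1 → ℂ)) :=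
    (hB0.1.aevalEquiv.symm.trans (MvPolynomial.renameEquiv k e)).trans hB1.1.aevalEquiv
  refine ⟨IsAlgClosure.equivOfEquiv ℂ ℂ E.toRingEquiv, ?_, ?_⟩
  · intro x
    have := IsAlgClosure.equivOfEquiv_algebraMap ℂ ℂ E.toRingEquiv (algebraMap k _ x)
    rw [← IsScalarTower.algebraMap_apply] at this
    rw [this]
    change ((E (algebraMap k _ x)) : ℂ) = _
    rw [AlgEquiv.commutes]
    rfl
  · have hx : E (hB0.1.aevalEquiv (MvPolynomial.X i0)) = hB1.1.aevalEquiv (MvPolynomial.X i1) := by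
      simp [E, he]
    have := IsAlgClosure.equivOfEquiv_algebraMap ℂ ℂ E.toRingEquiv (hB0.1.aevalEquiv (MvPolynomial.X i0))
    have a0 : algebraMap _ ℂ (hB0.1.aevalEquiv (MvPolynomial.X i0)) = z0 := by
      change ((hB0.1.aevalEquiv (MvPolynomial.X i0) : Algebra.adjoin k _) : ℂ) = z0
      simp [i0]
    rw [a0] at this
    rw [this]
    change ((E (hB0.1.aevalEquiv (MvPolynomial.X i0)) : Algebra.adjoin k _) : ℂ) = z1
    rw [hx]
    simp [i1]

theorem countable_alg (S : Set ℂ) (hS : S.Countable) :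
    {z : ℂ | IsAlgebraic (Subfield.closure S) z}.Countable := by
  haveI : Countable (Subfield.closure S) := by
    have := Subfield.cardinalMk_closure_le_max S
    rw [← Cardinal.mk_le_aleph0_iff]
    exact this.trans (max_le (Cardinal.mk_le_aleph0_iff.2 hS.to_subtype) le_rfl)
  exact Algebraic.countable _ _

/-- the transport principle -/
theorem transport (S : Set ℂ) (hS : S.Countable) (P : ℂ → Prop)
    (hP : ∀ τ : ℂ ≃+* ℂ, (∀ x ∈ S, τ x = x) → ∀ z, P z → P (τ z))
    (h0 : ∀ᶠ z in nhds (0 : ℂ), P z) (w : ℂ) : ∃ z : ℕ → ℂ, Filter.Tendsto z Filter.atTop (nhds w) ∧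
      ∀ n, P (z n) := by
  have hd := (countable_alg S hS).dense_compl ℝ
  obtain ⟨z0, hz0, hz0'⟩ := hd.inter_nhds_nonempty h0
  have hw : w ∈ closure ({z : ℂ | IsAlgebraic (Subfield.closure S) z}ᶜ) := hd w
  obtain ⟨z, hz, hzw⟩ := mem_closure_iff_seq_limit.1 hw
  refine ⟨z, hzw, fun n => ?_⟩
  obtain ⟨τ, h1, h2⟩ := exists_field_aut (k := Subfield.closure S) z0 (z n) hz0 (hz n)
  rw [← h2]
  exact hP τ (fun x hx => h1 ⟨x, Subfield.subset_closure hx⟩) _ hz0'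
end HornHalf
end

section
open Matrix
set_option linter.unusedSectionVars false

namespace HornHalf
variable {κ : Type*} [Fintype κ] [DecidableEq κ]

def Dec (𝓤 J : Matrix κ κ ℂ) (s c : κ → ℝ) (v : κ → Prop) (h : Matrix κ κ ℂ) : Prop :=
  ∃ g π q : Matrix κ κ ℂ, h = g * π * q ∧ IsUnit g ∧ IsUnit π ∧ IsUnit q ∧
      (g * J = J * g ∧ ∀ k l, g k l ≠ 0 → c k ≤ c l) ∧
      (∀ k l, π k l ≠ 0 → v l → v k) ∧
      (∀ k l, (𝓤ᴴ * q * 𝓤) k l ≠ 0 → s l ≤ s k)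

def Bg (J : Matrix κ κ ℂ) (c : κ → ℝ) : Submodule ℂ (Matrix κ κ ℂ) where
  carrier := {g | g * J = J * g ∧ ∀ k l, g k l ≠ 0 → c k ≤ c l}
  zero_mem' := by simp
  add_mem' := by
    rintro a b ⟨h1, h2⟩ ⟨h3, h4⟩
    refine ⟨by rw [add_mul, mul_add, h1, h3], fun k l h => ?_⟩
    by_contra hc
    have := mt (h2 k l) hc
    have := mt (h4 k l) hc
    push Not at *
    simp_all
  smul_mem' := by
    rintro r a ⟨h1, h2⟩
    refine ⟨by rw [smul_mul_assoc, mul_smul_comm, h1], fun k l h => h2 k l ?_⟩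
    rintro h'
    simp [h'] at h

def Bl (L : Matrix κ κ ℂ →ₗ[ℂ] Matrix κ κ ℂ) (R : κ → κ → Prop) : Submodule ℂ (Matrix κ κ ℂ) where
  carrier := {g | ∀ k l, L g k l ≠ 0 → R k l}
  zero_mem' := by simp
  add_mem' := by
    rintro a b h2 h4
    intro k l h
    by_contra hc
    have := mt (h2 k l) hc
    have := mt (h4 k l) hc
    push Not at *
    simp_all
  smul_mem' := by
    rintro r a h2
    refine fun k l h => h2 k l ?_
    rintro h'
    simp [h'] at h

theorem dec_seq (𝓤 J : Matrix κ κ ℂ) (s c : κ → ℝ) (v : κ → Prop) (hU : 𝓤ᴴ * 𝓤 = 1)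
    (H : ∀ M : Matrix κ κ ℂ, ∃ g π q : Matrix κ κ ℂ, M = g + π + q ∧
      (g * J = J * g ∧ ∀ k l, g k l ≠ 0 → c k ≤ c l) ∧
      (∀ k l, π k l ≠ 0 → v l → v k) ∧
      (∀ k l, (𝓤ᴴ * q * 𝓤) k l ≠ 0 → s l ≤ s k)) (h : Matrix κ κ ℂ) :
    ∃ hn : ℕ → Matrix κ κ ℂ, Filter.Tendsto hn Filter.atTop (nhds h) ∧ ∀ n, Dec 𝓤 J s c v (hn n) := by
  let L3 : Matrix κ κ ℂ →ₗ[ℂ] Matrix κ κ ℂ :=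
    { toFun := fun q => 𝓤ᴴ * q * 𝓤
      map_add' := by intro a b; rw [mul_add, add_mul]
      map_smul' := by intro a b; simp }
  have hloc := local_dec (Bg J c) (Bl LinearMap.id (fun k l => v l → v k)) (Bl L3 (fun k l => s l ≤ s k))
    (by refine ⟨by simp, fun k l hkl => ?_⟩
        by_cases hk : k = l
        · rw [hk]
        · simp [hk] at hkl)
    (by intro k l hkl
        by_cases hk : k = l
        · rw [hk]; exact id
        · simp [hk] at hkl)
    (by intro k l hkl
        by_cases hk : k = l
        · rw [hk]
        · have : L3 1 = 1 := by change 𝓤ᴴ * 1 * 𝓤 = 1; rw [mul_one, hU]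
          simp [this, hk] at hkl)
    (by intro M
        obtain ⟨g, π, q, h1, h2, h3, h4⟩ := H M
        exact ⟨g, h2, π, h3, q, h4, h1⟩) (h - 1)
  have hev : ∀ᶠ z in nhds (0 : ℂ), Dec 𝓤 J s c v (1 + z • (h - 1)) := by
    filter_upwards [hloc] with z hz
    obtain ⟨x, hx, y, hy, w, hw, a, b, c, e⟩ := hz
    exact ⟨x, y, w, e, a, b, c, hx, hy, hw⟩
  obtain ⟨z, hz, hzP⟩ := transport (Set.range (fun t : κ × κ => 𝓤 t.1 t.2) ∪ Set.range (fun t : κ × κ => 𝓤ᴴ t.1 t.2)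
      ∪ Set.range (fun t : κ × κ => h t.1 t.2) ∪ Set.range (fun t : κ × κ => J t.1 t.2)) (by
        refine Set.Countable.union (Set.Countable.union (Set.Countable.union ?_ ?_) ?_) ?_ <;> exact Set.countable_range _)
      (fun z => Dec 𝓤 J s c v (1 + z • (h - 1))) (by
        intro τ hτ z hz
        obtain ⟨g, π, q, h1, hg, hπ, hq, ⟨h2, h2'⟩, h3, h4⟩ := hz
        let T := τ.mapMatrix (m := κ)
        have T1 : ∀ M k l, T M k l = τ (M k l) := fun _ _ _ => rfl
        have TU : T 𝓤 = 𝓤 := by ext k l; exact hτ _ (Or.inl (Or.inl (Or.inl ⟨(k, l), rfl⟩)))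
        have TU' : T 𝓤ᴴ = 𝓤ᴴ := by ext k l; exact hτ _ (Or.inl (Or.inl (Or.inr ⟨(k, l), rfl⟩)))
        have Th : T h = h := by ext k l; exact hτ _ (Or.inl (Or.inr ⟨(k, l), rfl⟩))
        have TJ : T J = J := by ext k l; exact hτ _ (Or.inr ⟨(k, l), rfl⟩)
        have Tne : ∀ M k l, T M k l ≠ 0 → M k l ≠ 0 := by
          intro M k l hM h0
          rw [T1, h0, map_zero] at hM
          exact hM rfl
        refine ⟨T g, T π, T q, ?_, hg.map T, hπ.map T, hq.map T, ⟨?_, fun k l hk => h2' k l (Tne _ _ _ hk)⟩,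
          fun k l hk => h3 k l (Tne _ _ _ hk), fun k l hk => h4 k l (Tne _ _ _ ?_)⟩
        · rw [← map_mul, ← map_mul, ← h1, map_add, map_one]
          congr 1
          have : T (z • (h - 1)) = τ z • T (h - 1) := by
            ext k l
            simp only [T1, Matrix.smul_apply, smul_eq_mul, map_mul]
          rw [this, map_sub, Th, map_one]
        · have := congrArg T h2
          rwa [map_mul, map_mul, TJ] at this
        · rwa [map_mul, map_mul, TU, TU'])
      hev 1
  refine ⟨fun n => 1 + z n • (h - 1), ?_, hzP⟩
  have := (hz.smul_const (h - 1)).const_add (1 : Matrix κ κ ℂ)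
  simpa using this
end HornHalf
end

section
open Matrix
set_option linter.unusedSectionVars false

namespace HornHalf
variable {κ : Type*} [Fintype κ] [DecidableEq κ]

theorem flag_frame {K : Type*} [Fintype K] [DecidableEq K] (A : Matrix κ K ℂ) (f : K → ℝ) (t : κ → ℝ)
    (L : Matrix K κ ℂ) (hL : L * A = 1) (hA : ∀ k i, A k i ≠ 0 → f i ≤ t k) :
    ∃ R R' : Matrix K K ℂ, R * R' = 1 ∧ R' * R = 1 ∧ (A * R)ᴴ * (A * R) = 1 ∧
      ∀ k i, (A * R) k i ≠ 0 → f i ≤ t k := by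
  let e0 := (Fintype.equivFin K).symm
  let g : Fin (Fintype.card K) → ℝ := fun n => - f (e0 n)
  let e : Fin (Fintype.card K) ≃ K := (Tuple.sort g).trans e0
  have he : ∀ m n, m ≤ n → f (e n) ≤ f (e m) := by
    intro m n hmn
    have := Tuple.monotone_sort g hmn
    simp only [Function.comp, g] at this
    simp only [e, Equiv.trans_apply]
    linarith
  let x : Fin (Fintype.card K) → EuclideanSpace ℂ κ := fun n => WithLp.toLp 2 (fun k => A k (e n))
  have hx : LinearIndependent ℂ x := by
    rw [Fintype.linearIndependent_iff]
    intro c hc i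
    have h1 : A *ᵥ (fun j => c (e.symm j)) = 0 := by
      ext k
      have := congrArg (fun y : EuclideanSpace ℂ κ => y k) hc
      simp only [x, WithLp.ofLp_sum, Finset.sum_apply, WithLp.ofLp_smul, Pi.smul_apply, smul_eq_mul] at this
      simp only [mulVec, dotProduct]
      rw [← e.sum_comp]
      simp only [Equiv.symm_apply_apply, Pi.zero_apply]
      exact (Finset.sum_congr rfl fun _ _ => mul_comm _ _).trans this
    have h2 : L *ᵥ (A *ᵥ (fun j => c (e.symm j))) = 0 := by rw [h1, mulVec_zero]
    rw [mulVec_mulVec, hL, one_mulVec] at h2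
    have := congrFun h2 (e i)
    simpa using this
  let y := InnerProductSpace.gramSchmidtNormed ℂ x
  have hy : Orthonormal ℂ y := InnerProductSpace.gramSchmidtNormed_orthonormal hx
  have hys : ∀ n, y n ∈ Submodule.span ℂ (Set.image x (Set.Iic n)) := fun n =>
    Submodule.smul_mem _ _ (InnerProductSpace.gramSchmidt_mem_span ℂ x le_rfl)
  have hyr : ∀ n, ∃ c : Fin (Fintype.card K) → ℂ, ∑ i, c i • x i = y n := fun n =>
    (Submodule.mem_span_range_iff_exists_fun ℂ).1 (Submodule.span_mono (Set.image_subset_range _ _) (hys n))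
  choose c hc using hyr
  let R : Matrix K K ℂ := fun i j => c (e.symm j) (e.symm i)
  have hAR : ∀ k j, (A * R) k j = y (e.symm j) k := by
    intro k j
    rw [← hc, mul_apply, ← e.sum_comp]
    simp only [x, R, WithLp.ofLp_sum, Finset.sum_apply, WithLp.ofLp_smul, Pi.smul_apply, smul_eq_mul,
      Equiv.symm_apply_apply]
    exact Finset.sum_congr rfl fun _ _ => mul_comm _ _
  have hon : (A * R)ᴴ * (A * R) = 1 := by
    ext i j
    have h1 := (orthonormal_iff_ite.1 hy) (e.symm i) (e.symm j)
    rw [mul_apply, one_apply]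
    simp only [conjTranspose_apply, hAR]
    rw [PiLp.inner_apply] at h1
    simp only [EmbeddingLike.apply_eq_iff_eq] at h1
    rw [← h1]
    refine Finset.sum_congr rfl fun k _ => ?_
    rw [RCLike.inner_apply, mul_comm]
    rfl
  have hinv : (Rᴴ * Aᴴ * A) * R = 1 := by
    rw [← hon, conjTranspose_mul]
    simp only [Matrix.mul_assoc]
  refine ⟨R, Rᴴ * Aᴴ * A, mul_eq_one_comm.1 hinv, hinv, hon, ?_⟩
  intro k i h
  rw [hAR] at h
  by_contra hlt
  apply h
  have : ∀ w ∈ Submodule.span ℂ (Set.image x (Set.Iic (e.symm i))), w k = 0 := by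
    intro w hw
    induction hw using Submodule.span_induction with
    | mem w hw =>
      obtain ⟨n, hn, rfl⟩ := hw
      change A k (e n) = 0
      by_contra h0
      have h1 := hA _ _ h0
      have h2 := he _ _ (show n ≤ e.symm i from hn)
      simp only [Equiv.apply_symm_apply] at h2
      exact hlt (h2.trans h1)
    | zero => rfl
    | add a b _ _ ha hb => simp [ha, hb]
    | smul r a _ ha => simp [ha]
  exact this _ (hys _)

section
variable {K : Type*} [Fintype K] [DecidableEq K]

def inc (j : K → κ) : Matrix κ K ℂ := fun k i => if k = j i then 1 else 0

theorem mul_inc (j : K → κ) (M : Matrix κ κ ℂ) (k : κ) (i : K) :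
    (M * inc j) k i = M k (j i) := by
  simp [mul_apply, inc]

theorem inc_mul (j : K → κ) (hj : Function.Injective j) (v : κ → Prop) (hjv : ∀ k, v k ↔ ∃ i, j i = k)
    (M : Matrix κ κ ℂ) (hM : ∀ k l, M k l ≠ 0 → v l → v k) :
    M * inc j = inc j * M.submatrix j j := by
  ext k i
  rw [mul_inc, mul_apply]
  by_cases hk : v k
  · obtain ⟨k, rfl⟩ := (hjv k).1 hk
    rw [Finset.sum_eq_single k]
    · simp [inc]
    · intro b _ hb
      have : j k ≠ j b := fun h => hb (hj h.symm)
      simp [inc, this]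
    · simp
  · have h0 : M k (j i) = 0 := by
      by_contra h0
      exact hk (hM _ _ h0 ((hjv _).2 ⟨i, rfl⟩))
    rw [h0, Finset.sum_eq_zero]
    intro b _
    have : k ≠ j b := fun h => hk ((hjv _).2 ⟨b, h.symm⟩)
    simp [inc, this]

theorem inc_left (j : K → κ) (hj : Function.Injective j) : (inc j)ᵀ * inc j = 1 := by
  ext i k
  simp [mul_apply, inc, one_apply, hj.eq_iff]
  split_ifs <;> simp_all

def Sol (𝓤 J : Matrix κ κ ℂ) (s c : κ → ℝ) (j : K → κ) (h : Matrix κ κ ℂ) : Prop :=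
  ∃ (A B : Matrix κ K ℂ) (C E : Matrix K K ℂ), Aᴴ * A = 1 ∧ Bᴴ * B = 1 ∧
    (∀ k i, A k i ≠ 0 → s (j i) ≤ s k) ∧ (∀ k i, B k i ≠ 0 → c k ≤ c (j i)) ∧ h * 𝓤 * A = B * C ∧ J * B = B * E

theorem sol_of_dec (𝓤 J : Matrix κ κ ℂ) (s c : κ → ℝ) (v : κ → Prop) (j : K → κ) (hj : Function.Injective j)
    (hjv : ∀ k, v k ↔ ∃ i, j i = k) (h : Matrix κ κ ℂ)
    (hU : 𝓤ᴴ * 𝓤 = 1) (hUv : ∀ k l, ¬ (v k ↔ v l) → 𝓤 k l = 0) (hJv : ∀ k l, ¬ (v k ↔ v l) → J k l = 0)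
    (hd : Dec 𝓤 J s c v h) : Sol 𝓤 J s c j h := by
  obtain ⟨g, π, q, hh, hg, hπ, hq, ⟨hgJ, hgc⟩, hπv, hqs⟩ := hd
  have hU' : 𝓤 * 𝓤ᴴ = 1 := mul_eq_one_comm.1 hU
  set Q := 𝓤ᴴ * q * 𝓤 with hQ
  have hQu : IsUnit Q := by
    have u1 : IsUnit 𝓤 := IsUnit.of_mul_eq_one _ hU'
    have u2 : IsUnit 𝓤ᴴ := IsUnit.of_mul_eq_one _ hU
    exact (u2.mul hq).mul u1
  have hQd : IsUnit Q.det := (Matrix.isUnit_iff_isUnit_det Q).1 hQu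
  have hgd : IsUnit g.det := (Matrix.isUnit_iff_isUnit_det g).1 hg
  have := hQu.invertible
  have hbt : BlockTriangular Q (fun k => - s k) := by
    intro k l hkl
    by_contra h0
    have := hqs k l h0
    simp only at hkl
    linarith
  have hbt' := blockTriangular_inv_of_blockTriangular hbt
  obtain ⟨R, R', hR1, hR2, hR3, hR4⟩ := flag_frame (Q⁻¹ * inc j) (fun i => s (j i)) s ((inc j)ᵀ * Q)
    (by rw [Matrix.mul_assoc, ← Matrix.mul_assoc Q, mul_nonsing_inv _ hQd, Matrix.one_mul, inc_left j hj])
    (by intro k i hki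
        rw [mul_inc] at hki
        by_contra hlt
        exact hki (hbt' (show - s (j i) < - s k by linarith)))
  obtain ⟨P, P', hP1, hP2, hP3, hP4⟩ := flag_frame (g * inc j) (fun i => - c (j i)) (fun k => - c k) ((inc j)ᵀ * g⁻¹)
    (by rw [Matrix.mul_assoc, ← Matrix.mul_assoc g⁻¹, nonsing_inv_mul _ hgd, Matrix.one_mul, inc_left j hj])
    (by intro k i hki
        rw [mul_inc] at hki
        have := hgc _ _ hki
        linarith)
  have e1 := inc_mul j hj v hjv 𝓤 (fun k l h0 hl => by
    by_contra hk
    exact h0 (hUv k l (by tauto)))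
  have e2 := inc_mul j hj v hjv J (fun k l h0 hl => by
    by_contra hk
    exact h0 (hJv k l (by tauto)))
  have e3 := inc_mul j hj v hjv π hπv
  set Ur := 𝓤.submatrix j j
  set Jr := J.submatrix j j
  set πr := π.submatrix j j
  refine ⟨_, _, P' * (πr * Ur * R), P' * (Jr * P), hR3, hP3, hR4, fun k i hki => by
    have := hP4 k i hki; linarith, ?_, ?_⟩
  · have a1 : q * 𝓤 * Q⁻¹ = 𝓤 := by
      have : q * 𝓤 = 𝓤 * Q := by
        rw [hQ, ← Matrix.mul_assoc, ← Matrix.mul_assoc, hU', Matrix.one_mul]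
      rw [this, Matrix.mul_assoc, mul_nonsing_inv _ hQd, Matrix.mul_one]
    calc h * 𝓤 * (Q⁻¹ * inc j * R) = g * π * ((q * 𝓤 * Q⁻¹) * inc j) * R := by
          rw [hh]; simp only [Matrix.mul_assoc]
      _ = g * (π * inc j) * Ur * R := by rw [a1, e1]; simp only [Matrix.mul_assoc]
      _ = g * inc j * (1 : Matrix K K ℂ) * (πr * Ur * R) := by rw [e3]; simp only [Matrix.mul_assoc, Matrix.one_mul]
      _ = _ := by rw [← hP1]; simp only [Matrix.mul_assoc]
  · calc J * (g * inc j * P) = (J * g) * inc j * P := by simp only [Matrix.mul_assoc]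
      _ = g * (J * inc j) * P := by rw [← hgJ]; simp only [Matrix.mul_assoc]
      _ = g * inc j * (1 : Matrix K K ℂ) * (Jr * P) := by rw [e2]; simp only [Matrix.mul_assoc, Matrix.one_mul]
      _ = _ := by rw [← hP1]; simp only [Matrix.mul_assoc]
end
end HornHalf
end

section
open Matrix
set_option linter.unusedSectionVars false

namespace HornHalf
variable {κ : Type*} [Fintype κ] [DecidableEq κ]
variable {K : Type*} [Fintype K] [DecidableEq K]

theorem frame_norm (A : Matrix κ K ℂ) (i : K) (h : Aᴴ * A = 1) : ∑ k, ‖A k i‖ ^ 2 = 1 := by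
  have := congrFun (congrFun h i) i
  rw [mul_apply, one_apply_eq] at this
  simp only [conjTranspose_apply, RCLike.star_def] at this
  have h2 : ∀ k, (starRingEnd ℂ) (A k i) * A k i = ((‖A k i‖ ^ 2 : ℝ) : ℂ) := by
    intro k
    rw [RCLike.conj_mul]
    push_cast
    rfl
  simp only [h2] at this
  exact_mod_cast this

theorem frame_le (A : Matrix κ K ℂ) (k : κ) (i : K) (h : Aᴴ * A = 1) : ‖A k i‖ ≤ 1 := by
  have h1 := frame_norm A i h
  have h2 : ‖A k i‖ ^ 2 ≤ ∑ k, ‖A k i‖ ^ 2 :=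
    Finset.single_le_sum (f := fun k => ‖A k i‖ ^ 2) (fun _ _ => by positivity) (Finset.mem_univ k)
  rw [h1] at h2
  nlinarith [norm_nonneg (A k i)]

theorem compact_box : IsCompact {A : Matrix κ K ℂ | ∀ k i, ‖A k i‖ ≤ 1} := by
  have h1 : IsCompact (Set.univ.pi fun _ : κ => Set.univ.pi fun _ : K => Metric.closedBall (0 : ℂ) 1) :=
    isCompact_univ_pi fun _ => isCompact_univ_pi fun _ => isCompact_closedBall _ _
  have h2 : (Set.univ.pi fun _ : κ => Set.univ.pi fun _ : K => Metric.closedBall (0 : ℂ) 1) =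
      {A : κ → K → ℂ | ∀ k i, ‖A k i‖ ≤ 1} := by
    ext A
    simp [Set.mem_pi]
  rw [h2] at h1
  exact h1

theorem entT {l m : Type*} {X : ℕ → Matrix l m ℂ} {X0 : Matrix l m ℂ}
    (h1 : Filter.Tendsto X Filter.atTop (nhds X0)) (k : l) (i : m) :
    Filter.Tendsto (fun n => X n k i) Filter.atTop (nhds (X0 k i)) :=
  ((continuous_id.matrix_elem k i).tendsto X0).comp h1

theorem mulT {l m n : Type*} [Fintype m] {X : ℕ → Matrix l m ℂ} {Y : ℕ → Matrix m n ℂ}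
    {X0 : Matrix l m ℂ} {Y0 : Matrix m n ℂ}
    (h1 : Filter.Tendsto X Filter.atTop (nhds X0)) (h2 : Filter.Tendsto Y Filter.atTop (nhds Y0)) :
    Filter.Tendsto (fun t => X t * Y t) Filter.atTop (nhds (X0 * Y0)) := by
  have h3 : ∀ i j, Filter.Tendsto (fun t => (X t * Y t) i j) Filter.atTop (nhds ((X0 * Y0) i j)) := by
    intro i j
    simp only [mul_apply]
    exact tendsto_finsetSum _ fun k _ => (entT h1 i k).mul (entT h2 k j)
  exact tendsto_pi_nhds.2 fun i => tendsto_pi_nhds.2 fun j => h3 i j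

theorem lim_ne {l m : Type*} {X : ℕ → Matrix l m ℂ} {X0 : Matrix l m ℂ}
    (h1 : Filter.Tendsto X Filter.atTop (nhds X0)) (k : l) (i : m) (h : X0 k i ≠ 0) : ∃ n, X n k i ≠ 0 :=
  ((entT h1 k i).eventually_ne h).exists

theorem sol_lim (𝓤 J : Matrix κ κ ℂ) (s c : κ → ℝ) (j : K → κ) (hn : ℕ → Matrix κ κ ℂ) (h : Matrix κ κ ℂ)
    (hl : Filter.Tendsto hn Filter.atTop (nhds h)) (hs : ∀ n, Sol 𝓤 J s c j (hn n)) : Sol 𝓤 J s c j h := by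
  choose A B C E hA hB hAs hBc hC hE using hs
  have : FirstCountableTopology (Matrix κ K ℂ) := inferInstanceAs (FirstCountableTopology (κ → K → ℂ))
  have : T2Space (Matrix κ K ℂ) := inferInstanceAs (T2Space (κ → K → ℂ))
  obtain ⟨⟨A0, B0⟩, -, φ, hφ, hlim⟩ := ((compact_box (κ := κ) (K := K)).prod (compact_box (κ := κ) (K := K))).tendsto_subseq
    (x := fun n => (A n, B n)) (fun n => ⟨fun k i => frame_le _ k i (hA n), fun k i => frame_le _ k i (hB n)⟩)
  have lA : Filter.Tendsto (fun n => A (φ n)) Filter.atTop (nhds A0) := (continuous_fst.tendsto _).comp hlim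
  have lB : Filter.Tendsto (fun n => B (φ n)) Filter.atTop (nhds B0) := (continuous_snd.tendsto _).comp hlim
  have lh : Filter.Tendsto (fun n => hn (φ n)) Filter.atTop (nhds h) := hl.comp hφ.tendsto_atTop
  have lAH : Filter.Tendsto (fun n => (A (φ n))ᴴ) Filter.atTop (nhds A0ᴴ) :=
    ((continuous_id.matrix_conjTranspose).tendsto A0).comp lA
  have lBH : Filter.Tendsto (fun n => (B (φ n))ᴴ) Filter.atTop (nhds B0ᴴ) :=
    ((continuous_id.matrix_conjTranspose).tendsto B0).comp lB
  have key : ∀ n (Y : Matrix K K ℂ), B n * ((B n)ᴴ * (B n * Y)) = B n * Y := by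
    intro n Y
    rw [← Matrix.mul_assoc (B n)ᴴ, hB, Matrix.one_mul]
  have lC := mulT (mulT lh (tendsto_const_nhds (x := 𝓤))) lA
  have lE := mulT (tendsto_const_nhds (x := J)) lB
  refine ⟨A0, B0, B0ᴴ * (h * 𝓤 * A0), B0ᴴ * (J * B0), ?_, ?_, ?_, ?_, ?_, ?_⟩
  · have := mulT lAH lA
    simp only [hA] at this
    exact (tendsto_nhds_unique this tendsto_const_nhds)
  · have := mulT lBH lB
    simp only [hB] at this
    exact (tendsto_nhds_unique this tendsto_const_nhds)
  · intro k i h0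
    obtain ⟨n, hn⟩ := lim_ne lA k i h0
    exact hAs _ _ _ hn
  · intro k i h0
    obtain ⟨n, hn⟩ := lim_ne lB k i h0
    exact hBc _ _ _ hn
  · refine tendsto_nhds_unique lC ?_
    have := mulT lB (mulT lBH lC)
    refine this.congr fun n => ?_
    rw [hC, key]
  · refine tendsto_nhds_unique lE ?_
    have := mulT lB (mulT lBH lE)
    refine this.congr fun n => ?_
    rw [hE, key]

theorem trace_frame (A : Matrix κ K ℂ) (s : κ → ℝ) :
    trace (Aᴴ * diagonal (fun k => (s k : ℂ)) * A) = ((∑ i, ∑ k, ‖A k i‖ ^ 2 * s k : ℝ) : ℂ) := by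
  rw [trace]
  push_cast
  refine Finset.sum_congr rfl fun i _ => ?_
  rw [diag_apply, mul_apply]
  refine Finset.sum_congr rfl fun k _ => ?_
  rw [mul_diagonal, conjTranspose_apply, RCLike.star_def, mul_right_comm, RCLike.conj_mul]
  rfl

theorem sol_ineq (𝓤 J h : Matrix κ κ ℂ) (s c : κ → ℝ) (j : K → κ) (hJ : Jᴴ * J = 1)
    (hV : (h * 𝓤)ᴴ * (h * 𝓤) = 1)
    (hS : h * 𝓤 * diagonal (fun k => (s k : ℂ)) * (h * 𝓤)ᴴ +
      Jᴴ * (h * 𝓤 * diagonal (fun k => (s k : ℂ)) * (h * 𝓤)ᴴ) * J = diagonal (fun k => (c k : ℂ)))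
    (hsol : Sol 𝓤 J s c j h) : 2 * ∑ i, s (j i) ≤ ∑ i, c (j i) := by
  obtain ⟨A, B, C, E, hA, hB, hAs, hBc, hC, hE⟩ := hsol
  set V := h * 𝓤
  set S := V * diagonal (fun k => (s k : ℂ)) * Vᴴ with hSdef
  have hCC : Cᴴ * C = 1 := by
    have : Cᴴ * C = (B * C)ᴴ * (B * C) := by
      rw [conjTranspose_mul, Matrix.mul_assoc, ← Matrix.mul_assoc Bᴴ, hB, Matrix.one_mul]
    rw [this, ← hC, conjTranspose_mul, Matrix.mul_assoc, ← Matrix.mul_assoc Vᴴ, hV, Matrix.one_mul, hA]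
  have hEE : Eᴴ * E = 1 := by
    have : Eᴴ * E = (B * E)ᴴ * (B * E) := by
      rw [conjTranspose_mul, Matrix.mul_assoc, ← Matrix.mul_assoc Bᴴ, hB, Matrix.one_mul]
    rw [this, ← hE, conjTranspose_mul, Matrix.mul_assoc, ← Matrix.mul_assoc Jᴴ, hJ, Matrix.one_mul, hB]
  have trc : ∀ (X Y : Matrix K K ℂ), Xᴴ * X = 1 → trace (Xᴴ * Y * X) = trace Y := by
    intro X Y hX
    rw [trace_mul_comm, ← Matrix.mul_assoc, mul_eq_one_comm.1 hX, Matrix.one_mul]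
  have e1 : trace (Aᴴ * diagonal (fun k => (s k : ℂ)) * A) = trace (Bᴴ * S * B) := by
    rw [← trc C (Bᴴ * S * B) hCC]
    have : Cᴴ * (Bᴴ * S * B) * C = (B * C)ᴴ * S * (B * C) := by
      rw [conjTranspose_mul]; simp only [Matrix.mul_assoc]
    rw [this, ← hC, hSdef, conjTranspose_mul]
    have : Aᴴ * Vᴴ * (V * diagonal (fun k => (s k : ℂ)) * Vᴴ) * (V * A) =
      Aᴴ * ((Vᴴ * V) * diagonal (fun k => (s k : ℂ)) * (Vᴴ * V)) * A := by simp only [Matrix.mul_assoc]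
    rw [this, hV, Matrix.one_mul, Matrix.mul_one]
  have e2 : trace (Bᴴ * (Jᴴ * S * J) * B) = trace (Bᴴ * S * B) := by
    rw [← trc E (Bᴴ * S * B) hEE]
    have : Eᴴ * (Bᴴ * S * B) * E = (B * E)ᴴ * S * (B * E) := by
      rw [conjTranspose_mul]; simp only [Matrix.mul_assoc]
    rw [this, ← hE, conjTranspose_mul]
    simp only [Matrix.mul_assoc]
  have e3 : trace (Bᴴ * diagonal (fun k => (c k : ℂ)) * B) = 2 * trace (Aᴴ * diagonal (fun k => (s k : ℂ)) * A) := by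
    rw [← hS, Matrix.mul_add, Matrix.add_mul, trace_add, e2, e1, two_mul]
  rw [trace_frame, trace_frame] at e3
  have e4 : (∑ i, ∑ k, ‖B k i‖ ^ 2 * c k : ℝ) = 2 * ∑ i, ∑ k, ‖A k i‖ ^ 2 * s k := by exact_mod_cast e3
  have e5 : ∑ i, s (j i) ≤ ∑ i, ∑ k, ‖A k i‖ ^ 2 * s k := by
    refine Finset.sum_le_sum fun i _ => ?_
    calc s (j i) = ∑ k, ‖A k i‖ ^ 2 * s (j i) := by rw [← Finset.sum_mul, frame_norm A i hA, one_mul]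
      _ ≤ _ := by
        refine Finset.sum_le_sum fun k _ => ?_
        by_cases h0 : A k i = 0
        · simp [h0]
        · exact mul_le_mul_of_nonneg_left (hAs _ _ h0) (by positivity)
  have e6 : ∑ i, ∑ k, ‖B k i‖ ^ 2 * c k ≤ ∑ i, c (j i) := by
    refine Finset.sum_le_sum fun i _ => ?_
    calc _ ≤ ∑ k, ‖B k i‖ ^ 2 * c (j i) := by
          refine Finset.sum_le_sum fun k _ => ?_
          by_cases h0 : B k i = 0
          · simp [h0]
          · exact mul_le_mul_of_nonneg_left (hBc _ _ h0) (by positivity)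
      _ = c (j i) := by rw [← Finset.sum_mul, frame_norm B i hB, one_mul]
  linarith
end HornHalf
end

section
open Matrix
set_option linter.unusedSectionVars false

namespace HornHalf
variable {ι : Type*} [Fintype ι] [DecidableEq ι]

theorem core_contra (𝓤 : Matrix (ι ⊕ ι) (ι ⊕ ι) ℂ) (s : ι ⊕ ι → ℝ) (γ δ : ι → ℝ) (h𝓤 : 𝓤ᴴ * 𝓤 = 1)
    (h𝓤v : ∀ k l, ¬ (0 < Sum.elim δ δ k ↔ 0 < Sum.elim δ δ l) → 𝓤 k l = 0)
    (hS : 𝓤 * diagonal (fun k => (s k : ℂ)) * 𝓤ᴴ +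
      (J0 ι ℂ)ᴴ * (𝓤 * diagonal (fun k => (s k : ℂ)) * 𝓤ᴴ) * J0 ι ℂ =
      diagonal (fun k => ((Sum.elim γ γ k + Sum.elim δ δ k : ℝ) : ℂ)))
    (hdim : Nat.card {t : (ι ⊕ ι) × (ι ⊕ ι) // 0 < Sum.elim δ δ t.1 ∧ ¬ 0 < Sum.elim δ δ t.2} ≤
      Nat.card {t : ι × ι // 0 < δ t.1 ∧ ¬ 0 < δ t.2 ∧ γ t.2 ≤ γ t.1} +
      (Nat.card {t : ι × ι // 0 < δ t.1 ∧ ¬ 0 < δ t.2 ∧ γ t.2 ≤ γ t.1} +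
      Nat.card {t : (ι ⊕ ι) × (ι ⊕ ι) // 0 < Sum.elim δ δ t.1 ∧ ¬ 0 < Sum.elim δ δ t.2 ∧
        s t.1 ≤ s t.2}))
    (𝓥 : Matrix (ι ⊕ ι) (ι ⊕ ι) ℂ) (h𝓥 : 𝓥ᴴ * 𝓥 = 1)
    (hS1 : 𝓥 * diagonal (fun k => (s k : ℂ)) * 𝓥ᴴ +
      (J0 ι ℂ)ᴴ * (𝓥 * diagonal (fun k => (s k : ℂ)) * 𝓥ᴴ) * J0 ι ℂ =
      diagonal (fun k => ((Sum.elim γ γ k : ℝ) : ℂ)))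
    (hex : ∃ i, 0 < δ i) : False := by
  classical
  obtain ⟨i0, hi0⟩ := hex
  obtain ⟨m, j, hj', hjv'⟩ : ∃ (m : ℕ) (j : Fin m → ι ⊕ ι), Function.Injective j ∧
      ∀ k, 0 < Sum.elim δ δ k ↔ ∃ i, j i = k := by
    let e := Fintype.equivFin {k : ι ⊕ ι // 0 < Sum.elim δ δ k}
    refine ⟨_, fun i => (e.symm i).1, Subtype.val_injective.comp e.symm.injective, fun k => ?_⟩
    exact ⟨fun h => ⟨e ⟨k, h⟩, by simp⟩, fun ⟨i, hi⟩ => hi ▸ (e.symm i).2⟩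
  have hJv : ∀ k l, ¬ (0 < Sum.elim δ δ k ↔ 0 < Sum.elim δ δ l) → J0 ι ℂ k l = 0 := by
    intro k l h
    apply J0_supp (fun i => 0 < δ i)
    rcases k with k | k <;> rcases l with l | l <;> simpa using h
  have hh : 𝓥 * 𝓤ᴴ * 𝓤 = 𝓥 := by rw [Matrix.mul_assoc, h𝓤, Matrix.mul_one]
  obtain ⟨hn, hlim, hdec⟩ := dec_seq 𝓤 (J0 ι ℂ) s (Sum.elim γ γ) (fun k => 0 < Sum.elim δ δ k) h𝓤
    (transversality 𝓤 s γ δ h𝓤 h𝓤v hS hdim) (𝓥 * 𝓤ᴴ)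
  have hsol := sol_lim 𝓤 (J0 ι ℂ) s (Sum.elim γ γ) j hn _ hlim
    (fun n => sol_of_dec 𝓤 (J0 ι ℂ) s (Sum.elim γ γ) (fun k => 0 < Sum.elim δ δ k) j hj' hjv' _ h𝓤 h𝓤v hJv (hdec n))
  have h1 := sol_ineq 𝓤 (J0 ι ℂ) _ s (Sum.elim γ γ) j J0_unit (by rw [hh, h𝓥]) (by rw [hh, hS1]) hsol
  have h2 := sol_ineq 𝓤 (J0 ι ℂ) 1 (fun k => - s k) (fun k => - (Sum.elim γ γ k + Sum.elim δ δ k)) j J0_unit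
    (by rw [Matrix.one_mul, h𝓤])
    (by
      have e : ∀ f : ι ⊕ ι → ℝ, diagonal (fun k => ((- f k : ℝ) : ℂ)) = - diagonal (fun k => (f k : ℂ)) := by
        intro f
        rw [diagonal_neg]
        congr 1
        ext k
        simp
      rw [e, e (fun k => Sum.elim γ γ k + Sum.elim δ δ k), ← hS, Matrix.one_mul]
      simp only [Matrix.mul_neg, Matrix.neg_mul]
      abel)
    ⟨inc j, inc j, _, _, by
        have := inc_left j hj'
        have e : (inc j)ᴴ = (inc j)ᵀ := by
          ext a b
          simp only [conjTranspose_apply, transpose_apply, inc]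
          split_ifs <;> simp
        rw [e, this], by
        have := inc_left j hj'
        have e : (inc j)ᴴ = (inc j)ᵀ := by
          ext a b
          simp only [conjTranspose_apply, transpose_apply, inc]
          split_ifs <;> simp
        rw [e, this], by
        intro k i h
        have : k = j i := by by_contra h'; simp [inc, h'] at h
        rw [this], by
        intro k i h
        have : k = j i := by by_contra h'; simp [inc, h'] at h
        rw [this], by
        rw [Matrix.one_mul]
        exact inc_mul j hj' _ hjv' 𝓤 (fun k l h0 hl => by
          by_contra hk
          exact h0 (h𝓤v k l (by tauto))),
        inc_mul j hj' _ hjv' (J0 ι ℂ) (fun k l h0 hl => by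
          by_contra hk
          exact h0 (hJv k l (by tauto)))⟩
  have h3 : 0 < ∑ i, Sum.elim δ δ (j i) := by
    refine Finset.sum_pos (fun i _ => (hjv' _).2 ⟨i, rfl⟩) ?_
    obtain ⟨i, _⟩ := (hjv' (Sum.inl i0)).1 hi0
    exact ⟨i, Finset.mem_univ _⟩
  simp only [Finset.sum_neg_distrib, Finset.sum_add_distrib] at h2
  linarith
end HornHalf
end

section
open Matrix
set_option linter.unusedSectionVars false
namespace HornHalf
variable {κ : Type*} [Fintype κ] [DecidableEq κ]

theorem cspectral {ι : Type*} [Fintype ι] [DecidableEq ι] (A : Matrix ι ι ℂ) (hA : A.IsHermitian) :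
    ∃ (U : Matrix ι ι ℂ) (μ : ι → ℝ), Uᴴ * U = 1 ∧ U * Uᴴ = 1 ∧
      A = U * diagonal (fun i => (μ i : ℂ)) * Uᴴ := by
  refine ⟨hA.eigenvectorUnitary, hA.eigenvalues, ?_, ?_, ?_⟩
  · exact (Unitary.mem_iff.1 hA.eigenvectorUnitary.2).1
  · exact (Unitary.mem_iff.1 hA.eigenvectorUnitary.2).2
  · have := hA.spectral_theorem
    rw [Unitary.conjStarAlgAut_apply] at this
    exact this

/-- a frame of the range of an orthogonal projection -/
theorem proj_frame (P : Matrix κ κ ℂ) (hP : P.IsHermitian) (hPP : P * P = P) :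
    ∃ (m : ℕ) (Q : Matrix κ (Fin m) ℂ), Qᴴ * Q = 1 ∧ Q * Qᴴ = P := by
  obtain ⟨U, μ, hU, hU', h⟩ := cspectral P hP
  have h1 : diagonal (fun i => (μ i : ℂ)) = Uᴴ * P * U := by
    rw [h]
    calc _ = (1 : Matrix κ κ ℂ) * diagonal (fun i => (μ i : ℂ)) * 1 := by simp
      _ = _ := by rw [← hU]; simp only [Matrix.mul_assoc]
  have h2 : diagonal (fun i => (μ i : ℂ)) * diagonal (fun i => (μ i : ℂ)) = diagonal (fun i => (μ i : ℂ)) := by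
    rw [h1]
    calc _ = Uᴴ * P * (U * Uᴴ) * P * U := by simp only [Matrix.mul_assoc]
      _ = Uᴴ * (P * P) * U := by rw [hU']; simp only [Matrix.mul_assoc, Matrix.mul_one, Matrix.one_mul]
      _ = _ := by rw [hPP]
  have h3 : ∀ i, μ i = 0 ∨ μ i = 1 := by
    intro i
    rw [diagonal_mul_diagonal] at h2
    have h4 := congrFun (diagonal_injective h2) i
    have h5 : μ i * μ i = μ i := by exact_mod_cast h4
    by_cases h0 : μ i = 0
    · exact Or.inl h0
    · exact Or.inr (mul_left_cancel₀ h0 (by rw [h5, mul_one]))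
  obtain ⟨m, j, hj, hjv⟩ : ∃ (m : ℕ) (j : Fin m → κ), Function.Injective j ∧
      ∀ k, μ k = 1 ↔ ∃ i, j i = k := by
    let e := Fintype.equivFin {k : κ // μ k = 1}
    refine ⟨_, fun i => (e.symm i).1, Subtype.val_injective.comp e.symm.injective, fun k => ?_⟩
    exact ⟨fun h => ⟨e ⟨k, h⟩, by simp⟩, fun ⟨i, hi⟩ => hi ▸ (e.symm i).2⟩
  refine ⟨m, U.submatrix id j, ?_, ?_⟩
  · rw [conjTranspose_submatrix, ← submatrix_mul _ _ _ _ _ Function.bijective_id, hU]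
    exact submatrix_one j hj
  · rw [h]
    ext a b
    rw [Matrix.mul_apply, Matrix.mul_apply]
    simp only [mul_diagonal, submatrix_apply, conjTranspose_apply, id]
    rw [← Finset.sum_subset (Finset.subset_univ (Finset.univ.image j))]
    · rw [Finset.sum_image (fun x _ y _ h => hj h)]
      refine Finset.sum_congr rfl fun i _ => ?_
      rw [(hjv (j i)).2 ⟨i, rfl⟩]; simp
    · intro k _ hk
      rcases h3 k with h0 | h0
      · simp [h0]
      · obtain ⟨i, rfl⟩ := (hjv k).1 h0
        simp at hk

/-- entrywise conjugate -/
def cj {m n : Type*} (A : Matrix m n ℂ) : Matrix m n ℂ := A.map star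

theorem cj_mul {l m n : Type*} [Fintype m] (A : Matrix l m ℂ) (B : Matrix m n ℂ) : cj (A * B) = cj A * cj B := by
  ext i j
  simp [cj, Matrix.mul_apply]

theorem cj_ct {m n : Type*} (A : Matrix m n ℂ) : cj (Aᴴ) = (cj A)ᴴ := by
  ext i j
  simp [cj]

theorem cj_one : cj (1 : Matrix κ κ ℂ) = 1 := by
  ext i j
  by_cases h : i = j <;> simp [cj, Matrix.one_apply, h]

theorem cj_real {m n : Type*} (A : Matrix m n ℝ) : cj (A.map (fun x => (x : ℂ))) = A.map (fun x => (x : ℂ)) := by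
  ext i j
  simp [cj]

theorem cj_diag (μ : κ → ℝ) : cj (diagonal (fun k => (μ k : ℂ))) = diagonal (fun k => (μ k : ℂ)) := by
  ext i j
  by_cases h : i = j <;> simp [cj, diagonal_apply, h]

theorem cj_smul {m n : Type*} (z : ℂ) (A : Matrix m n ℂ) : cj (z • A) = star z • cj A := by
  ext i j
  simp [cj]

theorem cframe (J H : Matrix κ κ ℂ) (hJ : Jᴴ = -J) (hJJ : J * J = -1) (hH : H.IsHermitian)
    (hc : H * J = J * H) :
    ∃ (m : ℕ) (Q : Matrix κ (Fin m) ℂ) (μ : Fin m → ℝ), Qᴴ * Q = 1 ∧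
      Q * Qᴴ = (1/2 : ℂ) • (1 - Complex.I • J) ∧
      J * Q = Complex.I • Q ∧ H * Q = Q * diagonal (fun k => (μ k : ℂ)) := by
  set P : Matrix κ κ ℂ := (1/2 : ℂ) • (1 - Complex.I • J) with hPd
  have hP : P.IsHermitian := by
    rw [Matrix.IsHermitian, hPd, conjTranspose_smul, conjTranspose_sub, conjTranspose_smul, hJ]
    simp
  have hPP : P * P = P := by
    rw [hPd]
    simp only [Matrix.smul_mul, Matrix.mul_smul, Matrix.sub_mul, Matrix.mul_sub, hJJ, Matrix.one_mul,
      Matrix.mul_one, smul_sub, smul_smul, smul_neg]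
    match_scalars
    · ring_nf
      rw [Complex.I_sq]
      norm_num
    · ring_nf
  have hPH : H * P = P * H := by
    rw [hPd]
    simp only [Matrix.smul_mul, Matrix.mul_smul, Matrix.sub_mul, Matrix.mul_sub, Matrix.one_mul,
      Matrix.mul_one, hc]
  have hJP : J * P = Complex.I • P := by
    rw [hPd]
    simp only [Matrix.mul_smul, Matrix.mul_sub, hJJ, Matrix.mul_one, smul_sub, smul_smul, smul_neg]
    rw [show Complex.I * (1/2 * Complex.I) = -(1/2) by ring_nf; simp; ring]
    module
  obtain ⟨m, Q, hQ, hQP⟩ := proj_frame P hP hPP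
  obtain ⟨R, μ, hR, hR', h⟩ := cspectral (Qᴴ * H * Q) (by
    rw [Matrix.IsHermitian, conjTranspose_mul, conjTranspose_mul, hH.eq, conjTranspose_conjTranspose,
      Matrix.mul_assoc])
  have hPQ : P * Q = Q := by rw [← hQP, Matrix.mul_assoc, hQ, Matrix.mul_one]
  refine ⟨m, Q * R, μ, ?_, ?_, ?_, ?_⟩
  · calc (Q * R)ᴴ * (Q * R) = Rᴴ * (Qᴴ * Q) * R := by rw [conjTranspose_mul]; simp only [Matrix.mul_assoc]
      _ = 1 := by rw [hQ, Matrix.mul_one, hR]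
  · calc (Q * R) * (Q * R)ᴴ = Q * (R * Rᴴ) * Qᴴ := by rw [conjTranspose_mul]; simp only [Matrix.mul_assoc]
      _ = P := by rw [hR', Matrix.mul_one, hQP]
  · calc J * (Q * R) = J * P * Q * R := by rw [Matrix.mul_assoc J P, hPQ, Matrix.mul_assoc]
      _ = _ := by rw [hJP, Matrix.smul_mul, Matrix.smul_mul, hPQ]
  · calc H * (Q * R) = H * P * Q * R := by rw [Matrix.mul_assoc H P, hPQ, Matrix.mul_assoc]
      _ = Q * (Qᴴ * H * Q) * R := by rw [hPH, ← hQP]; simp only [Matrix.mul_assoc]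
      _ = Q * R * diagonal (fun k => (μ k : ℂ)) * (Rᴴ * R) := by rw [h]; simp only [Matrix.mul_assoc]
      _ = _ := by rw [hR, Matrix.mul_one]
end HornHalf
end

section
open Matrix
set_option linter.unusedSectionVars false
namespace HornHalf
variable {κ : Type*} [Fintype κ] [DecidableEq κ]

theorem normal_form0 (J H : Matrix κ κ ℝ) (hJ : Jᵀ * J = 1) (hJJ : J * J = -1) (hH : H.IsSymm)
    (hc : H * J = J * H) :
    ∃ (m : ℕ) (W : Matrix κ (Fin m ⊕ Fin m) ℂ) (μ : Fin m → ℝ), Wᴴ * W = 1 ∧ W * Wᴴ = 1 ∧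
      J.map (fun x => (x : ℂ)) * W = W * J0 (Fin m) ℂ ∧
      H.map (fun x => (x : ℂ)) * W = W * diagonal (fun k => ((Sum.elim μ μ k : ℝ) : ℂ)) := by
  set Jc : Matrix κ κ ℂ := J.map (fun x => (x : ℂ)) with hJc
  set Hc : Matrix κ κ ℂ := H.map (fun x => (x : ℂ)) with hHc
  have hmm : ∀ A B : Matrix κ κ ℝ, (A * B).map (fun x => (x : ℂ)) =
      A.map (fun x => (x : ℂ)) * B.map (fun x => (x : ℂ)) := fun A B => by
    ext i j; simp [Matrix.mul_apply]
  have hJt : Jᵀ = -J := by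
    calc Jᵀ = -(Jᵀ * (J * J)) := by rw [hJJ]; simp
      _ = -J := by rw [← Matrix.mul_assoc, hJ, Matrix.one_mul]
  have hJ1 : Jcᴴ = -Jc := by
    ext i j
    have := congrFun (congrFun hJt i) j
    simp only [transpose_apply, neg_apply] at this
    simp [hJc, this]
  have hJ2 : Jc * Jc = -1 := by
    rw [hJc, ← hmm, hJJ]
    ext i j
    by_cases h : i = j <;> simp [Matrix.one_apply, h]
  have hH1 : Hc.IsHermitian := by
    ext i j
    have := congrFun (congrFun hH i) j
    simp only [transpose_apply] at this
    simp [hHc, this]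
  have hc1 : Hc * Jc = Jc * Hc := by rw [hJc, hHc, ← hmm, hc, hmm]
  obtain ⟨m, Q, μ, q1, q2, q3, q4⟩ := cframe Jc Hc hJ1 hJ2 hH1 hc1
  have r1 : (cj Q)ᴴ * cj Q = 1 := by rw [← cj_ct, ← cj_mul, q1, cj_one]
  have r2 : cj Q * (cj Q)ᴴ = (1/2 : ℂ) • (1 + Complex.I • Jc) := by
    rw [← cj_ct, ← cj_mul, q2]
    ext i j
    have e2 : (starRingEnd ℂ) 2 = 2 := Complex.conj_ofNat 2
    by_cases h : i = j <;> simp [cj, h, hJc, e2]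
  have r3 : Jc * cj Q = -(Complex.I • cj Q) := by
    have := congrArg cj q3
    rw [cj_mul, hJc, cj_real, cj_smul] at this
    simpa using this
  have r4 : Hc * cj Q = cj Q * diagonal (fun k => (μ k : ℂ)) := by
    have := congrArg cj q4
    rwa [cj_mul, cj_mul, hHc, cj_real, cj_diag] at this
  have r5 : Qᴴ * cj Q = 0 := by
    have e1 : Qᴴ * Jc * cj Q = -(Complex.I • (Qᴴ * cj Q)) := by
      rw [Matrix.mul_assoc, r3, Matrix.mul_neg, Matrix.mul_smul]
    have e2 : Qᴴ * Jc = Complex.I • Qᴴ := by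
      have := congrArg conjTranspose q3
      rw [conjTranspose_mul, hJ1, Matrix.mul_neg, conjTranspose_smul] at this
      rw [neg_eq_iff_eq_neg] at this
      rw [this]; simp
    rw [e2, Matrix.smul_mul, eq_neg_iff_add_eq_zero, ← two_smul ℂ, smul_smul] at e1
    exact (smul_eq_zero.1 e1).resolve_left (by simp)
  have r6 : (cj Q)ᴴ * Q = 0 := by
    have := congrArg conjTranspose r5
    simpa using this
  set r : ℂ := (((Real.sqrt 2)⁻¹ : ℝ) : ℂ) with hr
  have hrr : r * r = 1/2 := by
    rw [hr, ← Complex.ofReal_mul, ← mul_inv, Real.mul_self_sqrt (by norm_num)]; simp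
  have hrs : star r = r := by rw [hr]; exact Complex.conj_ofReal _
  set X := r • (Q + cj Q) with hX
  set Y := (r * Complex.I) • (Q - cj Q) with hY
  have hsI : star (r * Complex.I) = - (r * Complex.I) := by rw [star_mul', hrs]; simp
  have hXc : Xᴴ = r • (Qᴴ + (cj Q)ᴴ) := by rw [hX, conjTranspose_smul, hrs, conjTranspose_add]
  have hYc : Yᴴ = -((r * Complex.I) • (Qᴴ - (cj Q)ᴴ)) := by
    rw [hY, conjTranspose_smul, hsI, conjTranspose_sub, neg_smul]
  have hI : (r * Complex.I) * (r * Complex.I) = -(1/2) := by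
    rw [mul_mul_mul_comm, hrr, Complex.I_mul_I]; ring
  have hD : diagonal (fun k => ((Sum.elim μ μ k : ℝ) : ℂ)) =
      fromBlocks (diagonal (fun k => (μ k : ℂ))) 0 0 (diagonal (fun k => (μ k : ℂ))) := by
    rw [fromBlocks_diagonal]
    congr 1
    ext k
    rcases k with k | k <;> rfl
  refine ⟨m, fromCols X Y, μ, ?_, ?_, ?_, ?_⟩
  · rw [conjTranspose_fromCols_eq_fromRows_conjTranspose, fromRows_mul_fromCols, ← fromBlocks_one]
    congr 1
    · rw [hXc, hX, Matrix.smul_mul, Matrix.mul_smul, smul_smul, hrr]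
      simp only [Matrix.add_mul, Matrix.mul_add, q1, r1, r5, r6]
      module
    · rw [hXc, hY, Matrix.smul_mul, Matrix.mul_smul]
      simp only [Matrix.add_mul, Matrix.mul_sub, q1, r1, r5, r6]
      simp
    · rw [hYc, hX, Matrix.neg_mul, Matrix.smul_mul, Matrix.mul_smul]
      simp only [Matrix.sub_mul, Matrix.mul_add, q1, r1, r5, r6]
      simp
    · rw [hYc, hY, Matrix.neg_mul, Matrix.smul_mul, Matrix.mul_smul, smul_smul, hI]
      simp only [Matrix.sub_mul, Matrix.mul_sub, q1, r1, r5, r6]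
      module
  · rw [conjTranspose_fromCols_eq_fromRows_conjTranspose, fromCols_mul_fromRows, hXc, hYc, hX, hY,
      Matrix.mul_neg, Matrix.smul_mul, Matrix.mul_smul, Matrix.smul_mul, Matrix.mul_smul, smul_smul,
      smul_smul, hrr, hI, neg_smul, neg_neg, ← smul_add]
    have : (Q + cj Q) * (Qᴴ + (cj Q)ᴴ) + (Q - cj Q) * (Qᴴ - (cj Q)ᴴ) =
        (2:ℂ) • (Q * Qᴴ + cj Q * (cj Q)ᴴ) := by
      simp only [Matrix.sub_mul, Matrix.mul_sub, Matrix.add_mul, Matrix.mul_add]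
      module
    rw [this, q2, r2]
    module
  · have e1 : Jc * X = Y := by
      rw [hX, hY, Matrix.mul_smul, Matrix.mul_add, q3, r3]
      module
    have e2 : Jc * Y = -X := by
      rw [← e1, ← Matrix.mul_assoc, hJ2]; simp
    rw [mul_fromCols, J0, fromCols_mul_fromBlocks, e1, e2]
    simp
  · rw [mul_fromCols, hD, fromCols_mul_fromBlocks, Matrix.mul_zero, Matrix.mul_zero, zero_add, add_zero,
      hX, hY]
    simp only [Matrix.mul_smul, Matrix.smul_mul, Matrix.mul_add, Matrix.mul_sub, Matrix.add_mul,
      Matrix.sub_mul, q4, r4]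

theorem normal_form {p : ℕ} (J H : Matrix κ κ ℝ) (hJ : Jᵀ * J = 1) (hJJ : J * J = -1) (hH : H.IsSymm)
    (hc : H * J = J * H) (hcard : Fintype.card κ = 2 * p) (γ : Fin p → ℝ)
    (hγ : H.charpoly = (∏ i, (Polynomial.X - Polynomial.C (γ i))) ^ 2) :
    ∃ (W : Matrix κ (Fin p ⊕ Fin p) ℂ), Wᴴ * W = 1 ∧ W * Wᴴ = 1 ∧
      J.map (fun x => (x : ℂ)) * W = W * J0 (Fin p) ℂ ∧
      H.map (fun x => (x : ℂ)) * W = W * diagonal (fun k => ((Sum.elim γ γ k : ℝ) : ℂ)) := by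
  obtain ⟨m, W, μ, h1, h2, h3, h4⟩ := normal_form0 J H hJ hJJ hH hc
  have hm : m = p := by
    have e1 := congrArg trace h1
    have e2 := congrArg trace h2
    rw [trace_mul_comm, e2, trace_one, trace_one, hcard] at e1
    have e3 : 2 * p = Fintype.card (Fin m ⊕ Fin m) := by exact_mod_cast e1
    simp at e3
    omega
  subst hm
  set D : Matrix (Fin m ⊕ Fin m) (Fin m ⊕ Fin m) ℂ := diagonal (fun k => ((Sum.elim μ μ k : ℝ) : ℂ)) with hD
  have hHW : H.map (fun x => (x : ℂ)) = (W * D) * Wᴴ := by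
    rw [← h4, Matrix.mul_assoc, h2, Matrix.mul_one]
  have hch : (H.map (fun x => (x : ℂ))).charpoly = D.charpoly := by
    rw [hHW, Matrix.charpoly_mul_comm_of_le]
    · rw [← Matrix.mul_assoc, h1, Matrix.one_mul, hcard]
      simp [two_mul]
    · rw [hcard]; simp [two_mul]
  have hch2 : (H.map (fun x => (x : ℂ))).charpoly = H.charpoly.map Complex.ofRealHom :=
    Matrix.charpoly_map H Complex.ofRealHom
  have hch3 : D.charpoly = ((∏ i, (Polynomial.X - Polynomial.C (μ i))) ^ 2).map Complex.ofRealHom := by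
    rw [hD, charpoly_diagonal, Fintype.prod_sum_type]
    simp [Polynomial.map_prod, sq]
  have hsq : (∏ i, (Polynomial.X - Polynomial.C (μ i))) ^ 2 = (∏ i, (Polynomial.X - Polynomial.C (γ i))) ^ 2 := by
    rw [← hγ]
    apply Polynomial.map_injective Complex.ofRealHom Complex.ofReal_injective
    rw [← hch3, ← hch, hch2]
  have hmon : ∀ μ : Fin m → ℝ, (∏ i, (Polynomial.X - Polynomial.C (μ i))).Monic := fun μ =>
    Polynomial.monic_prod_of_monic _ _ fun i _ => Polynomial.monic_X_sub_C _
  have heq : ∏ i, (Polynomial.X - Polynomial.C (γ i)) = ∏ i, (Polynomial.X - Polynomial.C (μ i)) := by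
    rcases sq_eq_sq_iff_eq_or_eq_neg.1 hsq with h | h
    · exact h.symm
    · exfalso
      have := congrArg Polynomial.leadingCoeff h
      rw [Polynomial.leadingCoeff_neg, (hmon μ).leadingCoeff, (hmon γ).leadingCoeff] at this
      norm_num at this
  obtain ⟨e, he⟩ := exists_equiv_of_prod γ μ heq
  have hbij := (Equiv.sumCongr e e).bijective
  refine ⟨W.submatrix id (Equiv.sumCongr e e), ?_, ?_, ?_, ?_⟩
  · rw [conjTranspose_submatrix, ← submatrix_mul _ _ _ _ _ Function.bijective_id, h1]
    exact submatrix_one_equiv _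
  · rw [conjTranspose_submatrix, ← submatrix_mul _ _ _ _ _ hbij, h2]
    simp
  · have : J0 (Fin m) ℂ = (J0 (Fin m) ℂ).submatrix (Equiv.sumCongr e e) (Equiv.sumCongr e e) := by
      ext i j
      rcases i with i | i <;> rcases j with j | j <;> simp [J0, Matrix.one_apply]
    rw [this, ← submatrix_mul _ _ _ _ _ hbij, ← h3]
    rw [submatrix_mul _ _ _ _ _ Function.bijective_id]
    simp
  · have : diagonal (fun k => ((Sum.elim γ γ k : ℝ) : ℂ)) = D.submatrix (Equiv.sumCongr e e) (Equiv.sumCongr e e) := by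
      rw [hD, submatrix_diagonal_equiv]
      congr 1
      ext k
      rcases k with k | k <;> simp [he]
    rw [this, ← submatrix_mul _ _ _ _ _ hbij, ← h4]
    rw [submatrix_mul _ _ _ _ _ Function.bijective_id]
    simp
end HornHalf
end

section
open Matrix
set_option linter.unusedSectionVars false
namespace HornHalf
variable {κ : Type*} [Fintype κ] [DecidableEq κ]

theorem exV {p : ℕ} (J : Matrix κ κ ℝ) (hJ : Jᵀ * J = 1) (hJJ : J * J = -1) (hcard : Fintype.card κ = 2 * p)
    (σ : κ → ℝ) (γ : Fin p → ℝ)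
    (hγ : (diagonal σ + Jᵀ * diagonal σ * J).charpoly = (∏ i, (Polynomial.X - Polynomial.C (γ i))) ^ 2)
    (s : Fin p ⊕ Fin p → ℝ) (e : Fin p ⊕ Fin p ≃ κ) (hs : ∀ k, s k = σ (e k)) :
    ∃ 𝓥 : Matrix (Fin p ⊕ Fin p) (Fin p ⊕ Fin p) ℂ, 𝓥ᴴ * 𝓥 = 1 ∧
      𝓥 * diagonal (fun k => (s k : ℂ)) * 𝓥ᴴ +
      (J0 (Fin p) ℂ)ᴴ * (𝓥 * diagonal (fun k => (s k : ℂ)) * 𝓥ᴴ) * J0 (Fin p) ℂ =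
      diagonal (fun k => ((Sum.elim γ γ k : ℝ) : ℂ)) := by
  have hJt : Jᵀ = -J := by
    calc Jᵀ = -(Jᵀ * (J * J)) := by rw [hJJ]; simp
      _ = -J := by rw [← Matrix.mul_assoc, hJ, Matrix.one_mul]
  have hmm : ∀ A B : Matrix κ κ ℝ, (A * B).map (fun x => (x : ℂ)) =
      A.map (fun x => (x : ℂ)) * B.map (fun x => (x : ℂ)) := fun A B => by
    ext i j; simp [Matrix.mul_apply]
  obtain ⟨W, h1, h2, h3, h4⟩ := normal_form J (diagonal σ + Jᵀ * diagonal σ * J) hJ hJJ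
    (by
      rw [Matrix.IsSymm, transpose_add, transpose_mul, transpose_mul, transpose_transpose, diagonal_transpose,
        Matrix.mul_assoc])
    (by
      rw [hJt]
      simp only [Matrix.add_mul, Matrix.mul_add, Matrix.neg_mul, Matrix.mul_neg, ← Matrix.mul_assoc, hJJ]
      simp only [Matrix.mul_assoc, hJJ]
      rw [Matrix.mul_neg, Matrix.mul_neg, Matrix.mul_one, Matrix.one_mul,
        neg_neg, neg_neg, add_comm]) hcard γ hγ
  have hS : (W.submatrix e id)ᴴ * diagonal (fun k => (s k : ℂ)) * (W.submatrix e id)ᴴᴴ =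
      Wᴴ * diagonal (fun k => (σ k : ℂ)) * W := by
    have : diagonal (fun k => (s k : ℂ)) = (diagonal (fun k => (σ k : ℂ))).submatrix e e := by
      rw [submatrix_diagonal_equiv]
      congr 1
      ext k
      simp [hs]
    rw [conjTranspose_conjTranspose, this, conjTranspose_submatrix, ← submatrix_mul _ _ _ _ _ e.bijective,
      ← submatrix_mul _ _ _ _ _ e.bijective]
    simp
  refine ⟨(W.submatrix e id)ᴴ, ?_, ?_⟩
  · rw [conjTranspose_conjTranspose, conjTranspose_submatrix, ← submatrix_mul _ _ _ _ _ Function.bijective_id, h2]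
    exact submatrix_one_equiv _
  · rw [hS]
    have e1 : (J0 (Fin p) ℂ)ᴴ * Wᴴ = Wᴴ * (Jᵀ).map (fun x => (x : ℂ)) := by
      rw [← conjTranspose_mul, ← h3, conjTranspose_mul]
      congr 1
      ext i j
      simp
    calc _ = Wᴴ * diagonal (fun k => (σ k : ℂ)) * W + ((J0 (Fin p) ℂ)ᴴ * Wᴴ) * diagonal (fun k => (σ k : ℂ)) * (W * J0 (Fin p) ℂ) := by
            simp only [Matrix.mul_assoc]
      _ = Wᴴ * ((diagonal σ + Jᵀ * diagonal σ * J).map (fun x => (x : ℂ)) * W) := by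
            have hd : diagonal (fun k => (σ k : ℂ)) = (diagonal σ).map (fun x => (x : ℂ)) := by
              rw [diagonal_map (by simp)]
            have ha : ∀ A B : Matrix κ κ ℝ, (A + B).map (fun x => (x : ℂ)) =
                A.map (fun x => (x : ℂ)) + B.map (fun x => (x : ℂ)) := fun A B => by
              ext i j; simp
            rw [e1, ← h3, ha, hmm, hmm, hd]
            simp only [Matrix.mul_assoc, Matrix.add_mul, Matrix.mul_add]
      _ = _ := by rw [h4, ← Matrix.mul_assoc, h1, Matrix.one_mul]

theorem orth_compact : IsCompact {O : Matrix κ κ ℝ | Oᵀ * O = 1} := by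
  have hb : IsCompact {A : Matrix κ κ ℝ | ∀ i j, A i j ∈ Set.Icc (-1 : ℝ) 1} := by
    have : {A : Matrix κ κ ℝ | ∀ i j, A i j ∈ Set.Icc (-1 : ℝ) 1} =
        Set.pi Set.univ (fun _ : κ => Set.pi Set.univ (fun _ : κ => Set.Icc (-1 : ℝ) 1)) := by
      ext A
      constructor
      · intro h i _ j _
        exact h i j
      · intro h i j
        exact h i trivial j trivial
    rw [this]
    exact isCompact_univ_pi fun _ => isCompact_univ_pi fun _ => isCompact_Icc
  refine hb.of_isClosed_subset (isClosed_eq (by fun_prop) continuous_const) ?_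
  intro O hO i j
  have h := congrFun (congrFun (show Oᵀ * O = 1 from hO) j) j
  rw [Matrix.mul_apply, Matrix.one_apply_eq] at h
  simp only [transpose_apply] at h
  have h2 : O i j * O i j ≤ 1 := by
    rw [← h]
    exact Finset.single_le_sum (f := fun k => O k j * O k j) (fun k _ => mul_self_nonneg _) (Finset.mem_univ i)
  rw [Set.mem_Icc]
  constructor <;> nlinarith

theorem exists_min (a b c : Matrix κ κ ℝ) : ∃ O₁ O₂ O₃ : Matrix κ κ ℝ, O₁ᵀ * O₁ = 1 ∧ O₂ᵀ * O₂ = 1 ∧ O₃ᵀ * O₃ = 1 ∧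
    ∀ P₁ P₂ P₃ : Matrix κ κ ℝ, P₁ᵀ * P₁ = 1 → P₂ᵀ * P₂ = 1 → P₃ᵀ * P₃ = 1 →
      trace ((O₁ * a * O₁ᵀ + O₂ * b * O₂ᵀ - O₃ * c * O₃ᵀ) * (O₁ * a * O₁ᵀ + O₂ * b * O₂ᵀ - O₃ * c * O₃ᵀ)) ≤
      trace ((P₁ * a * P₁ᵀ + P₂ * b * P₂ᵀ - P₃ * c * P₃ᵀ) * (P₁ * a * P₁ᵀ + P₂ * b * P₂ᵀ - P₃ * c * P₃ᵀ)) := by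
  have hK := (orth_compact (κ := κ)).prod ((orth_compact (κ := κ)).prod (orth_compact (κ := κ)))
  let f : Matrix κ κ ℝ × Matrix κ κ ℝ × Matrix κ κ ℝ → ℝ := fun O =>
      trace ((O.1 * a * O.1ᵀ + O.2.1 * b * O.2.1ᵀ - O.2.2 * c * O.2.2ᵀ) *
        (O.1 * a * O.1ᵀ + O.2.1 * b * O.2.1ᵀ - O.2.2 * c * O.2.2ᵀ))
  have hf : Continuous f := by
    have e : Continuous fun O : Matrix κ κ ℝ × Matrix κ κ ℝ × Matrix κ κ ℝ =>
        (O.1 * a * O.1ᵀ + O.2.1 * b * O.2.1ᵀ - O.2.2 * c * O.2.2ᵀ) := by fun_prop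
    exact (e.matrix_mul e).matrix_trace
  have hne : ({O : Matrix κ κ ℝ | Oᵀ * O = 1} ×ˢ ({O : Matrix κ κ ℝ | Oᵀ * O = 1} ×ˢ
      {O : Matrix κ κ ℝ | Oᵀ * O = 1})).Nonempty := by
    have h1 : (1 : Matrix κ κ ℝ) ∈ {O : Matrix κ κ ℝ | Oᵀ * O = 1} := by
      show (1 : Matrix κ κ ℝ)ᵀ * 1 = 1
      rw [transpose_one, Matrix.mul_one]
    exact ⟨(1, 1, 1), h1, h1, h1⟩
  obtain ⟨⟨O₁, O₂, O₃⟩, ⟨h1, h2, h3⟩, hm⟩ := hK.exists_isMinOn hne hf.continuousOn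
  refine ⟨O₁, O₂, O₃, h1, h2, h3, fun P₁ P₂ P₃ g1 g2 g3 => ?_⟩
  exact isMinOn_iff.1 hm (P₁, P₂, P₃) ⟨g1, g2, g3⟩

theorem simdiag (c D : Matrix κ κ ℝ) (hc : c.IsSymm) (hD : D.IsSymm) (hcD : c * D = D * c) :
    ∃ (Q : Matrix κ κ ℝ) (δ γ : κ → ℝ), Qᵀ * Q = 1 ∧ Q * D * Qᵀ = diagonal δ ∧ Q * c * Qᵀ = diagonal γ := by
  obtain ⟨T, δ, hT, hTD⟩ := spectral0 D hD
  have hT' := mul_eq_one_comm.1 hT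
  have hTD' : diagonal δ = Tᵀ * D * T := by
    rw [hTD]
    calc _ = (1 : Matrix κ κ ℝ) * diagonal δ * 1 := by simp
      _ = _ := by rw [← hT]; simp only [Matrix.mul_assoc]
  obtain ⟨R, γ, hR, hRc, hRδ⟩ := spectral_comm (Tᵀ * c * T) (by
      rw [Matrix.IsSymm, transpose_mul, transpose_mul, transpose_transpose, hc.eq, Matrix.mul_assoc]) δ (by
      rw [hTD']
      calc _ = Tᵀ * c * (T * Tᵀ) * D * T := by simp only [Matrix.mul_assoc]
        _ = Tᵀ * D * (T * Tᵀ) * c * T := by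
            rw [hT', Matrix.mul_one, Matrix.mul_one, Matrix.mul_assoc Tᵀ, hcD, ← Matrix.mul_assoc Tᵀ]
        _ = _ := by simp only [Matrix.mul_assoc])
  have hR' := mul_eq_one_comm.1 hR
  have hRδ' : diagonal δ * R = R * diagonal δ := by
    ext i j
    rw [mul_diagonal, diagonal_mul]
    by_cases h : δ i = δ j
    · rw [h, mul_comm]
    · rw [hRδ i j h]; simp
  refine ⟨Rᵀ * Tᵀ, δ, γ, ?_, ?_, ?_⟩
  · rw [transpose_mul, transpose_transpose, transpose_transpose]
    calc T * R * (Rᵀ * Tᵀ) = T * (R * Rᵀ) * Tᵀ := by simp only [Matrix.mul_assoc]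
      _ = 1 := by rw [hR', Matrix.mul_one, hT']
  · rw [transpose_mul, transpose_transpose, transpose_transpose]
    calc _ = Rᵀ * (Tᵀ * D * T) * R := by simp only [Matrix.mul_assoc]
      _ = diagonal δ := by rw [← hTD', Matrix.mul_assoc, hRδ', ← Matrix.mul_assoc, hR, Matrix.one_mul]
  · rw [transpose_mul, transpose_transpose, transpose_transpose]
    calc _ = Rᵀ * (Tᵀ * c * T) * R := by simp only [Matrix.mul_assoc]
      _ = (Rᵀ * R) * diagonal γ * (Rᵀ * R) := by rw [hRc]; simp only [Matrix.mul_assoc]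
      _ = _ := by rw [hR, Matrix.one_mul, Matrix.mul_one]
end HornHalf
end

section
open Matrix
set_option linter.unusedSectionVars false
namespace HornHalf

theorem exists_pairing (p : ℕ) : ∃ e : Fin p ⊕ Fin p ≃ Fin (2 * p),
    (∀ i, (e (Sum.inl i)).1 = 2 * i.1) ∧ (∀ i, (e (Sum.inr i)).1 = 2 * i.1 + 1) := by
  let f : Fin p ⊕ Fin p → Fin (2 * p) := Sum.elim (fun i => ⟨2 * i.1, by have := i.2; omega⟩)
    (fun i => ⟨2 * i.1 + 1, by have := i.2; omega⟩)
  have hf : Function.Bijective f := by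
    rw [Fintype.bijective_iff_injective_and_card]
    constructor
    · rintro (i | i) (j | j) h <;> simp only [f, Sum.elim_inl, Sum.elim_inr, Fin.mk.injEq] at h
      · congr 1; ext; omega
      · omega
      · omega
      · congr 1; ext; omega
    · simp [two_mul]
  exact ⟨Equiv.ofBijective f hf, fun i => rfl, fun i => rfl⟩

theorem conj_trace {ι : Type*} [Fintype ι] [DecidableEq ι] (Q A : Matrix ι ι ℝ) (h : Qᵀ * Q = 1) :
    trace (Q * A * Qᵀ) = trace A := by
  rw [trace_mul_comm, ← Matrix.mul_assoc, h, Matrix.one_mul]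

theorem conj_trace_c {ι : Type*} [Fintype ι] [DecidableEq ι] (Q A : Matrix ι ι ℂ) (h : Qᴴ * Q = 1) :
    trace (Q * A * Qᴴ) = trace A := by
  rw [trace_mul_comm, ← Matrix.mul_assoc, h, Matrix.one_mul]

theorem conj_symm {ι : Type*} [Fintype ι] (Q A : Matrix ι ι ℝ) (hA : A.IsSymm) :
    (Q * A * Qᵀ).IsSymm := by
  rw [Matrix.IsSymm, transpose_mul, transpose_mul, transpose_transpose, hA.eq, Matrix.mul_assoc]

theorem orth_mul {ι : Type*} [Fintype ι] [DecidableEq ι] (P Q : Matrix ι ι ℝ) (hP : Pᵀ * P = 1) (hQ : Qᵀ * Q = 1) :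
    (P * Q)ᵀ * (P * Q) = 1 := by
  rw [transpose_mul]
  calc Qᵀ * Pᵀ * (P * Q) = Qᵀ * (Pᵀ * P) * Q := by simp only [Matrix.mul_assoc]
    _ = 1 := by rw [hP, Matrix.mul_one, hQ]

theorem conj_conj {ι : Type*} [Fintype ι] (P Q A : Matrix ι ι ℝ) :
    P * (Q * A * Qᵀ) * Pᵀ = (P * Q) * A * (P * Q)ᵀ := by
  rw [transpose_mul]; simp only [Matrix.mul_assoc]

theorem trace_id {ι : Type*} [Fintype ι] [DecidableEq ι] (α β γ : ι → ℝ) (𝓥 : Matrix (ι ⊕ ι) (ι ⊕ ι) ℂ)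
    (h𝓥 : 𝓥ᴴ * 𝓥 = 1)
    (hS1 : 𝓥 * diagonal (fun k => ((Sum.elim α β k : ℝ) : ℂ)) * 𝓥ᴴ +
      (J0 ι ℂ)ᴴ * (𝓥 * diagonal (fun k => ((Sum.elim α β k : ℝ) : ℂ)) * 𝓥ᴴ) * J0 ι ℂ =
      diagonal (fun k => ((Sum.elim γ γ k : ℝ) : ℂ))) :
    (∑ i, α i + ∑ i, β i) + (∑ i, α i + ∑ i, β i) = ∑ i, γ i + ∑ i, γ i := by
  have t1 := congrArg trace hS1
  have hj : J0 ι ℂ * (J0 ι ℂ)ᴴ = 1 := mul_eq_one_comm.1 (J0_unit (ι := ι))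
  have t2 : ∀ A, trace ((J0 ι ℂ)ᴴ * A * J0 ι ℂ) = trace A := by
    intro A
    rw [trace_mul_comm, ← Matrix.mul_assoc, hj, Matrix.one_mul]
  rw [trace_add, t2, conj_trace_c _ _ h𝓥, trace_diagonal, trace_diagonal, Fintype.sum_sum_type,
    Fintype.sum_sum_type] at t1
  simp only [Sum.elim_inl, Sum.elim_inr] at t1
  exact_mod_cast t1

set_option maxHeartbeats 1000000 in
theorem hard {p : ℕ} (σ : Fin (2 * p) → ℝ) (hσ : Antitone σ) (ν : Fin p → ℝ)
    (J : Matrix (Fin (2 * p)) (Fin (2 * p)) ℝ) (hJ : Jᵀ * J = 1) (hJJ : J * J = -1)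
    (hν : (diagonal σ + Jᵀ * diagonal σ * J).charpoly = (∏ i, (Polynomial.X - Polynomial.C (ν i))) ^ 2)
    (α0 β0 : Fin p → ℝ) (hα0 : ∀ i : Fin p, α0 i = σ ⟨2 * i.1, by have := i.2; omega⟩)
    (hβ0 : ∀ i : Fin p, β0 i = σ ⟨2 * i.1 + 1, by have := i.2; omega⟩) :
    ∃ O₁ O₂ O₃ : Matrix (Fin p) (Fin p) ℝ, O₁ᵀ * O₁ = 1 ∧ O₂ᵀ * O₂ = 1 ∧ O₃ᵀ * O₃ = 1 ∧
      O₁ * diagonal α0 * O₁ᵀ + O₂ * diagonal β0 * O₂ᵀ = O₃ * diagonal ν * O₃ᵀ := by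
  obtain ⟨O₁, O₂, O₃, o1, o2, o3, hmin0⟩ := exists_min (diagonal α0) (diagonal β0) (diagonal ν)
  refine ⟨O₁, O₂, O₃, o1, o2, o3, ?_⟩
  by_contra hne
  set a := O₁ * diagonal α0 * O₁ᵀ with ha
  set b := O₂ * diagonal β0 * O₂ᵀ with hb
  set c := O₃ * diagonal ν * O₃ᵀ with hc
  have pa : a.charpoly = ∏ i, (Polynomial.X - Polynomial.C (α0 i)) := charpoly_diag _ _ o1
  have pb : b.charpoly = ∏ i, (Polynomial.X - Polynomial.C (β0 i)) := charpoly_diag _ _ o2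
  have pc : c.charpoly = ∏ i, (Polynomial.X - Polynomial.C (ν i)) := charpoly_diag _ _ o3
  have hDne : a + b - c ≠ 0 := fun h => hne (sub_eq_zero.1 h)
  have sa : a.IsSymm := conj_symm _ _ (diagonal_transpose _)
  have sb : b.IsSymm := conj_symm _ _ (diagonal_transpose _)
  have sc : c.IsSymm := conj_symm _ _ (diagonal_transpose _)
  have sD : (a + b - c).IsSymm := (sa.add sb).sub sc
  have hmin1 : ∀ P₁ P₂ P₃ : Matrix (Fin p) (Fin p) ℝ, P₁ᵀ * P₁ = 1 → P₂ᵀ * P₂ = 1 → P₃ᵀ * P₃ = 1 →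
      trace ((a + b - c) * (a + b - c)) ≤
      trace ((P₁ * a * P₁ᵀ + P₂ * b * P₂ᵀ - P₃ * c * P₃ᵀ) * (P₁ * a * P₁ᵀ + P₂ * b * P₂ᵀ - P₃ * c * P₃ᵀ)) := by
    intro P₁ P₂ P₃ h1 h2 h3
    have := hmin0 _ _ _ (orth_mul P₁ O₁ h1 o1) (orth_mul P₂ O₂ h2 o2) (orth_mul P₃ O₃ h3 o3)
    rw [ha, hb, hc, conj_conj, conj_conj, conj_conj]
    exact this
  clear_value a b c
  have z0 : (0 : Matrix (Fin p) (Fin p) ℝ)ᵀ = -0 := by simp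
  have ca : a * (a + b - c) = (a + b - c) * a := by
    refine comm_of_first_order a _ sa sD fun X hX => ?_
    have := (second_order a b c hmin1 X 0 0 hX z0 z0).1
    simpa only [Matrix.zero_mul, Matrix.mul_zero, sub_zero, add_zero] using this
  have cb : b * (a + b - c) = (a + b - c) * b := by
    refine comm_of_first_order b _ sb sD fun X hX => ?_
    have := (second_order a b c hmin1 0 X 0 z0 hX z0).1
    simpa only [Matrix.zero_mul, Matrix.mul_zero, sub_zero, zero_add] using this
  have cc : c * (a + b - c) = (a + b - c) * c := by
    refine comm_of_first_order c _ sc sD fun X hX => ?_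
    have := (second_order a b c hmin1 0 0 X z0 z0 hX).1
    simpa only [Matrix.zero_mul, Matrix.mul_zero, sub_zero, zero_add, add_zero, zero_sub, Matrix.mul_neg, trace_neg,
      neg_eq_zero] using this
  obtain ⟨Q, δ, γ, hQ, hQD, hQc⟩ := simdiag c _ sc sD cc
  have hQ' := mul_eq_one_comm.1 hQ
  have hcm : ∀ A B : Matrix (Fin p) (Fin p) ℝ, (Q * A * Qᵀ) * (Q * B * Qᵀ) = Q * (A * B) * Qᵀ := by
    intro A B
    calc _ = Q * A * (Qᵀ * Q) * B * Qᵀ := by simp only [Matrix.mul_assoc]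
      _ = _ := by rw [hQ, Matrix.mul_one]; simp only [Matrix.mul_assoc]
  have hsum : Q * a * Qᵀ + Q * b * Qᵀ - diagonal γ = diagonal δ := by
    rw [← hQc, ← hQD]
    simp only [Matrix.mul_add, Matrix.add_mul, Matrix.mul_sub, Matrix.sub_mul]
  obtain ⟨U, α, hU, hUα, hUδ⟩ := spectral_comm (Q * a * Qᵀ) (conj_symm _ _ sa) δ
    (by rw [← hQD, hcm, hcm, ca])
  obtain ⟨V, β, hV, hVβ, hVδ⟩ := spectral_comm (Q * b * Qᵀ) (conj_symm _ _ sb) δ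
    (by rw [← hQD, hcm, hcm, cb])
  have hmin2 : ∀ P₁ P₂ P₃ : Matrix (Fin p) (Fin p) ℝ, P₁ᵀ * P₁ = 1 → P₂ᵀ * P₂ = 1 → P₃ᵀ * P₃ = 1 →
      trace ((Q * a * Qᵀ + Q * b * Qᵀ - diagonal γ) * (Q * a * Qᵀ + Q * b * Qᵀ - diagonal γ)) ≤
      trace ((P₁ * (Q * a * Qᵀ) * P₁ᵀ + P₂ * (Q * b * Qᵀ) * P₂ᵀ - P₃ * diagonal γ * P₃ᵀ) *
        (P₁ * (Q * a * Qᵀ) * P₁ᵀ + P₂ * (Q * b * Qᵀ) * P₂ᵀ - P₃ * diagonal γ * P₃ᵀ)) := by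
    intro P₁ P₂ P₃ h1 h2 h3
    rw [hsum, ← hQD, hcm, conj_trace _ _ hQ, ← hQc, conj_conj, conj_conj, conj_conj]
    exact hmin1 _ _ _ (orth_mul P₁ Q h1 hQ) (orth_mul P₂ Q h2 hQ) (orth_mul P₃ Q h3 hQ)
  have hcount := count_ineq (Q * a * Qᵀ) (Q * b * Qᵀ) U V α β γ δ hU hV hUδ hVδ hUα hVβ hsum hmin2
  have pα : ∏ i, (Polynomial.X - Polynomial.C (α i)) = ∏ i, (Polynomial.X - Polynomial.C (α0 i)) := by
    rw [← charpoly_diag U α hU, ← hUα, charpoly_conj _ _ hQ, pa]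
  have pβ : ∏ i, (Polynomial.X - Polynomial.C (β i)) = ∏ i, (Polynomial.X - Polynomial.C (β0 i)) := by
    rw [← charpoly_diag V β hV, ← hVβ, charpoly_conj _ _ hQ, pb]
  have pγ : ∏ i, (Polynomial.X - Polynomial.C (γ i)) = ∏ i, (Polynomial.X - Polynomial.C (ν i)) := by
    rw [← charpoly_diagonal, ← hQc, charpoly_conj _ _ hQ, pc]
  obtain ⟨ea, hea⟩ := exists_equiv_of_prod α α0 pα
  obtain ⟨eb, heb⟩ := exists_equiv_of_prod β β0 pβ
  have hdim := dim_ineq σ hσ α β γ δ ea eb (fun i => by rw [hea, hα0]) (fun i => by rw [heb, hβ0]) hcount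
  obtain ⟨e, he1, he2⟩ := exists_pairing p
  obtain ⟨𝓥, h𝓥, hS1⟩ := exV J hJ hJJ (by simp) σ γ (by rw [hν, pγ]) (Sum.elim α β)
    ((Equiv.sumCongr ea eb).trans e) (by
      rintro (i | i)
      · simp only [Sum.elim_inl, Equiv.trans_apply, Equiv.sumCongr_apply, Sum.map_inl]
        rw [hea, hα0]
        congr 1
        ext
        rw [he1]
      · simp only [Sum.elim_inr, Equiv.trans_apply, Equiv.sumCongr_apply, Sum.map_inr]
        rw [heb, hβ0]
        congr 1
        ext
        rw [he2])
  -- the trace of `δ` vanishes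
  have htr : ∑ i, δ i = 0 := by
    have t3 := trace_id α β γ 𝓥 h𝓥 hS1
    have t4 := congrArg trace hsum
    rw [trace_sub, trace_add, hUα, hVβ, conj_trace _ _ hU, conj_trace _ _ hV] at t4
    simp only [trace_diagonal] at t4
    linarith
  have hex : ∃ i, 0 < δ i := by
    by_contra hcon
    push Not at hcon
    have h0 : ∀ i ∈ Finset.univ, δ i = 0 := (Finset.sum_eq_zero_iff_of_nonpos fun i _ => hcon i).1 htr
    apply hDne
    have h1 : Q * (a + b - c) * Qᵀ = 0 := by
      rw [hQD, show δ = 0 from funext fun i => h0 i (Finset.mem_univ i)]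
      exact diagonal_zero
    calc a + b - c = (Qᵀ * Q) * (a + b - c) * (Qᵀ * Q) := by rw [hQ, Matrix.one_mul, Matrix.mul_one]
      _ = Qᵀ * (Q * (a + b - c) * Qᵀ) * Q := by simp only [Matrix.mul_assoc]
      _ = 0 := by rw [h1, Matrix.mul_zero, Matrix.zero_mul]
  set 𝓤0 : Matrix (Fin p ⊕ Fin p) (Fin p ⊕ Fin p) ℝ := fromBlocks U 0 0 V with h𝓤0
  have hUU0 : 𝓤0ᵀ * 𝓤0 = 1 := by
    rw [h𝓤0, fromBlocks_transpose, fromBlocks_multiply, ← fromBlocks_one, transpose_zero]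
    simp [hU, hV]
  have hmm : ∀ A B : Matrix (Fin p ⊕ Fin p) (Fin p ⊕ Fin p) ℝ, (A * B).map (fun x => (x : ℂ)) =
      A.map (fun x => (x : ℂ)) * B.map (fun x => (x : ℂ)) := fun A B => by
    ext i j; simp [Matrix.mul_apply]
  have hct : ∀ A : Matrix (Fin p ⊕ Fin p) (Fin p ⊕ Fin p) ℝ, (A.map (fun x => (x : ℂ)))ᴴ =
      Aᵀ.map (fun x => (x : ℂ)) := fun A => by
    ext i j; simp
  have hdg : ∀ f : Fin p ⊕ Fin p → ℝ, diagonal (fun k => (f k : ℂ)) = (diagonal f).map (fun x => (x : ℂ)) := by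
    intro f
    rw [diagonal_map (by simp)]
  have hJ0 : J0 (Fin p) ℂ = (J0 (Fin p) ℝ).map (fun x => (x : ℂ)) := by
    ext i j
    rcases i with i | i <;> rcases j with j | j <;> by_cases h : i = j <;> simp [J0, Matrix.one_apply, h]
  have hreal : 𝓤0 * diagonal (Sum.elim α β) * 𝓤0ᵀ +
      (J0 (Fin p) ℝ)ᵀ * (𝓤0 * diagonal (Sum.elim α β) * 𝓤0ᵀ) * J0 (Fin p) ℝ =
      diagonal (fun k => Sum.elim γ γ k + Sum.elim δ δ k) := by
    have e1 : 𝓤0 * diagonal (Sum.elim α β) * 𝓤0ᵀ = fromBlocks (Q * a * Qᵀ) 0 0 (Q * b * Qᵀ) := by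
      rw [hUα, hVβ, h𝓤0, ← fromBlocks_diagonal, fromBlocks_transpose, fromBlocks_multiply, fromBlocks_multiply]
      simp
    have e2 : diagonal (fun k => Sum.elim γ γ k + Sum.elim δ δ k) =
        fromBlocks (Q * a * Qᵀ + Q * b * Qᵀ) 0 0 (Q * a * Qᵀ + Q * b * Qᵀ) := by
      rw [sub_eq_iff_eq_add.1 hsum, diagonal_add, fromBlocks_diagonal]
      congr 1
      ext k
      rcases k with k | k <;> simp [add_comm]
    rw [e1, e2, J0, fromBlocks_transpose, fromBlocks_multiply, fromBlocks_multiply, fromBlocks_add]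
    simp [add_comm]
  refine core_contra (𝓤0.map (fun x => (x : ℂ))) (Sum.elim α β) γ δ ?_ ?_ ?_ hdim 𝓥 h𝓥 hS1 hex
  · rw [hct, ← hmm, hUU0]
    ext i j
    by_cases h : i = j <;> simp [Matrix.one_apply, h]
  · intro k l h
    rcases k with k | k <;> rcases l with l | l <;> simp only [Sum.elim_inl, Sum.elim_inr] at h
    · simp [h𝓤0, hUδ k l (fun hh => h (by rw [hh]))]
    · simp [h𝓤0]
    · simp [h𝓤0]
    · simp [h𝓤0, hVδ k l (fun hh => h (by rw [hh]))]
  · rw [hdg, hdg, hct, hJ0, hct, ← hmm, ← hmm, ← hmm, ← hmm, ← hreal]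
    ext i j
    simp
end HornHalf
end

section
open Matrix
set_option linter.unusedSectionVars false
namespace HornHalf

theorem prod_dup {p : ℕ} (ν : Fin p → ℝ) :
    ∏ i : Fin (2 * p), (Polynomial.X - Polynomial.C (ν ⟨i.1 / 2, by have := i.2; omega⟩)) =
      (∏ i, (Polynomial.X - Polynomial.C (ν i))) ^ 2 := by
  obtain ⟨e, he1, he2⟩ := exists_pairing p
  rw [← e.prod_comp, Fintype.prod_sum_type, sq]
  congr 1
  · refine Finset.prod_congr rfl fun i _ => ?_
    congr 3
    ext
    simp only [he1]
    omega
  · refine Finset.prod_congr rfl fun i _ => ?_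
    congr 3
    ext
    simp only [he2]
    omega

theorem easy0 {ι : Type*} [Fintype ι] [DecidableEq ι] (α β : ι → ℝ) (a b U V : Matrix ι ι ℝ)
    (hU : Uᵀ * U = 1) (hV : Vᵀ * V = 1) (ha : a = U * diagonal α * Uᵀ) (hb : b = V * diagonal β * Vᵀ) :
    ∃ K : Matrix (ι ⊕ ι) (ι ⊕ ι) ℝ, Kᵀ * K = 1 ∧ K * K = -1 ∧
      (diagonal (Sum.elim α β) + Kᵀ * diagonal (Sum.elim α β) * K).charpoly = (a + b).charpoly ^ 2 := by
  set 𝓤 : Matrix (ι ⊕ ι) (ι ⊕ ι) ℝ := fromBlocks U 0 0 V with h𝓤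
  have h1 : 𝓤ᵀ * 𝓤 = 1 := by
    rw [h𝓤, fromBlocks_transpose, fromBlocks_multiply, ← fromBlocks_one, transpose_zero]
    simp [hU, hV]
  have h2 : 𝓤 * 𝓤ᵀ = 1 := mul_eq_one_comm.1 h1
  have j1 : (J0 ι ℝ)ᵀ * J0 ι ℝ = 1 := by
    rw [J0, fromBlocks_transpose, fromBlocks_multiply, ← fromBlocks_one]
    simp
  have j2 : J0 ι ℝ * J0 ι ℝ = -1 := by
    rw [J0, fromBlocks_multiply, ← fromBlocks_one, fromBlocks_neg]
    simp
  have e1 : 𝓤 * diagonal (Sum.elim α β) * 𝓤ᵀ = fromBlocks a 0 0 b := by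
    rw [ha, hb, h𝓤, ← fromBlocks_diagonal, fromBlocks_transpose, fromBlocks_multiply, fromBlocks_multiply]
    simp
  have e2 : fromBlocks a 0 0 b + (J0 ι ℝ)ᵀ * fromBlocks a 0 0 b * J0 ι ℝ = fromBlocks (a + b) 0 0 (a + b) := by
    rw [J0, fromBlocks_transpose, fromBlocks_multiply, fromBlocks_multiply, fromBlocks_add]
    simp [add_comm]
  refine ⟨𝓤ᵀ * J0 ι ℝ * 𝓤, ?_, ?_, ?_⟩
  · rw [transpose_mul, transpose_mul, transpose_transpose]
    calc _ = 𝓤ᵀ * ((J0 ι ℝ)ᵀ * (𝓤 * 𝓤ᵀ) * J0 ι ℝ) * 𝓤 := by simp only [Matrix.mul_assoc]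
      _ = 1 := by rw [h2, Matrix.mul_one, j1, Matrix.mul_one, h1]
  · calc _ = 𝓤ᵀ * (J0 ι ℝ * (𝓤 * 𝓤ᵀ) * J0 ι ℝ) * 𝓤 := by simp only [Matrix.mul_assoc]
      _ = -1 := by rw [h2, Matrix.mul_one, j2, Matrix.mul_neg, Matrix.neg_mul, Matrix.mul_one, h1]
  · rw [← charpoly_conj 𝓤 _ h1, sq, ← charpoly_fromBlocks_zero₁₂ (M₁₁ := a + b) (M₂₁ := 0) (M₂₂ := a + b)]
    rw [transpose_mul, transpose_mul, transpose_transpose, Matrix.mul_add, Matrix.add_mul, e1, ← e2]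
    congr 2
    calc _ = (𝓤 * 𝓤ᵀ) * (J0 ι ℝ)ᵀ * (𝓤 * diagonal (Sum.elim α β) * 𝓤ᵀ) * J0 ι ℝ * (𝓤 * 𝓤ᵀ) := by
          simp only [Matrix.mul_assoc]
      _ = _ := by rw [h2, e1, Matrix.one_mul, Matrix.mul_one]

theorem easy {p : ℕ} (σ : Fin (2 * p) → ℝ) 
    (α0 β0 : Fin p → ℝ) (hα0 : ∀ i : Fin p, α0 i = σ ⟨2 * i.1, by have := i.2; omega⟩)
    (hβ0 : ∀ i : Fin p, β0 i = σ ⟨2 * i.1 + 1, by have := i.2; omega⟩)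
    (a b : Matrix (Fin p) (Fin p) ℝ) (sa : a.IsSymm) (sb : b.IsSymm)
    (ha : a.charpoly = ∏ i, (Polynomial.X - Polynomial.C (α0 i)))
    (hb : b.charpoly = ∏ i, (Polynomial.X - Polynomial.C (β0 i))) :
    ∃ J : Matrix (Fin (2 * p)) (Fin (2 * p)) ℝ, Jᵀ * J = 1 ∧ J * J = -1 ∧
      (diagonal σ + Jᵀ * diagonal σ * J).charpoly = (a + b).charpoly ^ 2 := by
  obtain ⟨U, hU, -, hUa⟩ := spectral a sa α0 ha
  obtain ⟨V, hV, -, hVb⟩ := spectral b sb β0 hb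
  obtain ⟨K, k1, k2, k3⟩ := easy0 α0 β0 a b U V hU hV hUa hVb
  obtain ⟨e, he1, he2⟩ := exists_pairing p
  have hd : diagonal σ = (diagonal (Sum.elim α0 β0)).submatrix e.symm e.symm := by
    rw [submatrix_diagonal_equiv]
    congr 1
    ext k
    obtain ⟨k, rfl⟩ := e.surjective k
    rw [Function.comp_apply, Equiv.symm_apply_apply]
    rcases k with k | k
    · rw [Sum.elim_inl, hα0]; congr 1; ext; simp [he1]
    · rw [Sum.elim_inr, hβ0]; congr 1; ext; simp [he2]
  have hb := e.symm.bijective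
  refine ⟨K.submatrix e.symm e.symm, ?_, ?_, ?_⟩
  · rw [transpose_submatrix, ← submatrix_mul _ _ _ _ _ hb, k1]
    exact submatrix_one_equiv _
  · rw [← submatrix_mul _ _ _ _ _ hb, k2, submatrix_neg]
    simp
  · rw [← k3, ← charpoly_reindex e]
    congr 1
    rw [hd, transpose_submatrix, ← submatrix_mul _ _ _ _ _ hb, ← submatrix_mul _ _ _ _ _ hb]
    rfl
end HornHalf
end

open Matrix in
/-- For weakly decreasing `σ ∈ ℝ^{2p}`, `S = diag σ`, and weakly
decreasing `ν ∈ ℝ^p`: there exists a complex structure `J` (real orthogonal,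
`J² = -Id`) with `S + J⁻¹ S J` of ordered spectrum `ν⁽²⁾`, iff there exist real
symmetric `p×p` matrices `a, b` with ordered spectra `σ₋, σ₊` and `a + b` of
ordered spectrum `ν`. -/
theorem complex_structure_iff_horn_half (p : ℕ)
    (σ : Fin (2 * p) → ℝ) (hσ : Antitone σ) (ν : Fin p → ℝ) (hν : Antitone ν) :
    (∃ J : Matrix (Fin (2 * p)) (Fin (2 * p)) ℝ, Jᵀ * J = 1 ∧ J * J = -1 ∧
      HasOrdSpecR (Matrix.diagonal σ + J⁻¹ * Matrix.diagonal σ * J) (dupR ν)) ↔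
    (∃ a b : Matrix (Fin p) (Fin p) ℝ, a.IsSymm ∧ b.IsSymm ∧
      HasOrdSpecR a (sminusR σ) ∧ HasOrdSpecR b (splusR σ) ∧ HasOrdSpecR (a + b) ν) := by
  constructor
  · rintro ⟨J, hJ, hJJ, -, hch⟩
    have hinv : J⁻¹ = Jᵀ := Matrix.inv_eq_left_inv hJ
    rw [hinv] at hch
    have hch2 : (Matrix.diagonal σ + Jᵀ * Matrix.diagonal σ * J).charpoly =
        (∏ i, (Polynomial.X - Polynomial.C (ν i))) ^ 2 := by
      rw [hch]
      exact HornHalf.prod_dup ν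
    obtain ⟨O₁, O₂, O₃, o1, o2, o3, h⟩ := HornHalf.hard σ hσ ν J hJ hJJ hch2 (sminusR σ) (splusR σ)
      (fun _ => rfl) (fun _ => rfl)
    refine ⟨O₁ * diagonal (sminusR σ) * O₁ᵀ, O₂ * diagonal (splusR σ) * O₂ᵀ,
      HornHalf.conj_symm _ _ (diagonal_transpose _), HornHalf.conj_symm _ _ (diagonal_transpose _),
      ⟨?_, HornHalf.charpoly_diag _ _ o1⟩, ⟨?_, HornHalf.charpoly_diag _ _ o2⟩, ⟨hν, ?_⟩⟩
    · intro i j hij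
      refine hσ (Fin.mk_le_mk.2 ?_)
      have : i.1 ≤ j.1 := hij
      omega
    · intro i j hij
      refine hσ (Fin.mk_le_mk.2 ?_)
      have : i.1 ≤ j.1 := hij
      omega
    · rw [h]
      exact HornHalf.charpoly_diag _ _ o3
  · rintro ⟨a, b, sa, sb, ⟨-, ha⟩, ⟨-, hb⟩, ⟨-, hab⟩⟩
    obtain ⟨J, hJ, hJJ, hch⟩ := HornHalf.easy σ (sminusR σ) (splusR σ)
      (fun _ => rfl) (fun _ => rfl) a b sa sb ha hb
    refine ⟨J, hJ, hJJ, ?_, ?_⟩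
    · intro i j hij
      refine hν (Fin.mk_le_mk.2 ?_)
      have : i.1 ≤ j.1 := hij
      omega
    · have hinv : J⁻¹ = Jᵀ := Matrix.inv_eq_left_inv hJ
      rw [hinv, hch, hab]
      exact (HornHalf.prod_dup ν).symm
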